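/- Let f : ℝⁿ → ℝ be analytic near 0 with f(0) = 0, ∇f(0) = 0, let r ≥ 1, and let g be analytic near 0 with g − f ∈ (f)^{r+2}, where (f) is the ideal generated by f in the ring of analytic germs at 0. Then f and g are C^r-right equivalent: there exists a C^r diffeomorphism φ : (ℝⁿ,0) → (ℝⁿ,0) such that f = g ∘ φ in a neighborhood of 0. -/

import Mathlib

section SecPart1
open Filter Topology Set

section Hadamard
variable {E : Type*} [NormedAddCommGroup E] [NormedSpace ℝ E]

theorem lj_int_analytic {G : Type*} [NormedAddCommGroup G] [NormedSpace ℝ G] [CompleteSpace G]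
    (F : E → G) (hF : AnalyticAt ℝ F 0) (L : ℝ → (E →L[ℝ] E)) (hL : Continuous L) :
    AnalyticAt ℝ (fun x => ∫ s in (0:ℝ)..1, F (L s x)) 0 := by
  obtain ⟨p, r, hp⟩ := hF
  obtain ⟨K0, hK0⟩ := (isCompact_Icc (a := (0:ℝ)) (b := 1)).exists_bound_of_continuousOn hL.continuousOn
  set K : ℝ := max K0 1 with hK
  have hK1 : (1:ℝ) ≤ K := le_max_right _ _
  have hKpos : 0 < K := by linarith
  have hLK : ∀ s ∈ Icc (0:ℝ) 1, ‖L s‖ ≤ K := fun s hs => (hK0 s hs).trans (le_max_left _ _)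
  obtain ⟨ρ, hρ0, hρr⟩ := ENNReal.lt_iff_exists_nnreal_btwn.1 hp.r_pos
  have hρ0' : (0:ℝ) < ρ := by exact_mod_cast hρ0
  have hsum : Summable (fun n => ‖p n‖ * (ρ:ℝ) ^ n) :=
    p.summable_norm_mul_pow (hρr.trans_le hp.r_le)
  let M : (n : ℕ) → ℝ → (E [×n]→L[ℝ] G) := fun n s => (p n).compContinuousLinearMap (fun _ => L s)
  have hMc : ∀ n, Continuous (M n) := by
    intro n
    have h1 := (ContinuousMultilinearMap.compContinuousLinearMapContinuousMultilinear ℝ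
      (fun _ : Fin n => E) (fun _ : Fin n => E) G).cont
    have h2 : Continuous (fun s : ℝ => (fun _ : Fin n => L s)) := continuous_pi fun _ => hL
    have h3 := h1.comp h2
    exact h3.clm_apply continuous_const
  have hMn : ∀ n, ∀ s ∈ Icc (0:ℝ) 1, ‖M n s‖ ≤ ‖p n‖ * K ^ n := by
    intro n s hs
    refine (ContinuousMultilinearMap.norm_compContinuousLinearMap_le _ _).trans ?_
    gcongr
    simp only [Finset.prod_const, Finset.card_univ, Fintype.card_fin]
    gcongr
    exact hLK s hs
  let q : FormalMultilinearSeries ℝ E G := fun n => ∫ s in (0:ℝ)..1, M n s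
  have hqn : ∀ n, ‖q n‖ ≤ ‖p n‖ * K ^ n := by
    intro n
    have := intervalIntegral.norm_integral_le_of_norm_le_const (a := 0) (b := 1) (f := M n)
      (C := ‖p n‖ * K ^ n) (by
        intro s hs
        rw [uIoc_of_le zero_le_one] at hs
        exact hMn n s ⟨hs.1.le, hs.2⟩)
    simpa using this
  let ρ' : NNReal := ρ / ⟨K, hKpos.le⟩
  have hρ' : (ρ' : ℝ) = ρ / K := NNReal.coe_div _ _
  have hρ'0 : (0:ℝ) < ρ' := by rw [hρ']; positivity
  refine ⟨q, ρ', ?_, by exact_mod_cast hρ'0, ?_⟩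
  · apply q.le_radius_of_summable_norm
    refine Summable.of_nonneg_of_le (fun n => by positivity) (fun n => ?_) hsum
    calc ‖q n‖ * (ρ':ℝ) ^ n ≤ (‖p n‖ * K ^ n) * (ρ':ℝ) ^ n := by gcongr; exact hqn n
      _ = ‖p n‖ * (ρ:ℝ) ^ n := by
        rw [hρ', div_pow]; field_simp
  · intro y hy
    have hy' : ‖y‖ < ρ / K := by
      have : ‖y‖ < ρ' := by
        rw [Metric.mem_eball, edist_zero_right, enorm_eq_nnnorm] at hy
        exact_mod_cast hy
      rwa [hρ'] at this
    have hKy : K * ‖y‖ < ρ := by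
      rw [lt_div_iff₀ hKpos] at hy'; linarith
    have hLy : ∀ s ∈ Icc (0:ℝ) 1, ‖L s y‖ ≤ K * ‖y‖ := fun s hs =>
      ((L s).le_opNorm y).trans (by gcongr; exact hLK s hs)
    simp only [zero_add]
    have hq : ∀ n, q n (fun _ => y) = ∫ s in (0:ℝ)..1, p n (fun _ => L s y) := by
      intro n
      have h1 := (ContinuousMultilinearMap.apply ℝ (fun _ : Fin n => E) G (fun _ => y)).intervalIntegral_comp_comm
        ((hMc n).intervalIntegrable 0 1 (μ := MeasureTheory.volume))
      simpa [M, q] using h1.symm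
    simp only [hq]
    refine intervalIntegral.hasSum_integral_of_dominated_convergence
      (bound := fun n _ => ‖p n‖ * (ρ:ℝ) ^ n) ?_ ?_ ?_ ?_ ?_
    · intro n
      refine Continuous.aestronglyMeasurable ?_
      have : Continuous fun s => (M n s) (fun _ => y) := by
        exact (ContinuousMultilinearMap.apply ℝ (fun _ : Fin n => E) G (fun _ => y)).continuous.comp (hMc n)
      exact this
    · intro n
      refine Eventually.of_forall fun s hs => ?_
      rw [uIoc_of_le zero_le_one] at hs
      refine ((p n).le_opNorm _).trans ?_
      simp only [Finset.prod_const, Finset.card_univ, Fintype.card_fin]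
      gcongr
      exact (hLy s ⟨hs.1.le, hs.2⟩).trans hKy.le
    · exact Eventually.of_forall fun s _ => hsum
    · simp
    · refine Eventually.of_forall fun s hs => ?_
      rw [uIoc_of_le zero_le_one] at hs
      have := hp.hasSum (y := L s y) (by
        have h1 : ‖L s y‖ < ρ := (hLy s ⟨hs.1.le, hs.2⟩).trans_lt hKy
        refine lt_trans ?_ hρr
        rw [edist_zero_right, enorm_eq_nnnorm]
        exact_mod_cast h1)
      simpa using this

theorem lj_hadamard (F : E → ℝ) (hF : AnalyticAt ℝ F 0) (ℓ : E →L[ℝ] ℝ) (v : E) :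
    ∃ G : E → ℝ, AnalyticAt ℝ G 0 ∧ ∀ᶠ x in 𝓝 0, F x = F (x - ℓ x • v) + ℓ x * G x := by
  let L : ℝ → (E →L[ℝ] E) := fun s => ContinuousLinearMap.id ℝ E - (1 - s) • ℓ.smulRight v
  have hL : Continuous L := by fun_prop
  have hF' : AnalyticAt ℝ (fun x => fderiv ℝ F x v) 0 :=
    ((ContinuousLinearMap.apply ℝ ℝ v).analyticAt _).comp hF.fderiv
  refine ⟨_, lj_int_analytic _ hF' L hL, ?_⟩
  obtain ⟨ε, hε, hball⟩ := Metric.eventually_nhds_iff_ball.1 hF.eventually_analyticAt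
  obtain ⟨K0, hK0⟩ := (isCompact_Icc (a := (0:ℝ)) (b := 1)).exists_bound_of_continuousOn hL.continuousOn
  set K : ℝ := max K0 1 with hK
  have hK1 : (1:ℝ) ≤ K := le_max_right _ _
  have hKpos : 0 < K := by linarith
  have hLK : ∀ s ∈ Icc (0:ℝ) 1, ‖L s‖ ≤ K := fun s hs => (hK0 s hs).trans (le_max_left _ _)
  filter_upwards [Metric.ball_mem_nhds (0:E) (div_pos hε hKpos)] with x hx
  have hx' : K * ‖x‖ < ε := by
    rw [mem_ball_zero_iff, lt_div_iff₀ hKpos] at hx; linarith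
  have hin : ∀ s ∈ Icc (0:ℝ) 1, AnalyticAt ℝ F (L s x) := by
    intro s hs
    apply hball
    rw [mem_ball_zero_iff]
    exact (((L s).le_opNorm x).trans (by gcongr; exact hLK s hs)).trans_lt hx'
  have hder : ∀ s ∈ uIcc (0:ℝ) 1, HasDerivAt (fun s => F (L s x)) (ℓ x * fderiv ℝ F (L s x) v) s := by
    intro s hs
    rw [uIcc_of_le zero_le_one] at hs
    have h1 : HasDerivAt (fun s : ℝ => L s x) (ℓ x • v) s := by
      have : (fun s : ℝ => L s x) = fun s => x - (1 - s) • (ℓ x • v) := by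
        ext s; simp [L]
      rw [this]
      have h2 : HasDerivAt (fun s : ℝ => (1 - s)) (-1) s := by
        simpa using (hasDerivAt_id s).const_sub 1
      simpa using (h2.smul_const (ℓ x • v)).const_sub x
    have := (hin s hs).differentiableAt.hasFDerivAt.comp_hasDerivAt s h1
    rw [map_smul, smul_eq_mul] at this
    exact this
  have hcont : ContinuousOn (fun s => ℓ x * fderiv ℝ F (L s x) v) (uIcc 0 1) := by
    intro s hs
    rw [uIcc_of_le zero_le_one] at hs
    have h1 : ContinuousAt (fderiv ℝ F) (L s x) := (hin s hs).fderiv.continuousAt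
    have h2 : ContinuousAt (fun s => L s x) s := by fun_prop
    have h3 : ContinuousAt (fun s => fderiv ℝ F (L s x)) s := ContinuousAt.comp (f := fun s => L s x) h1 h2
    exact (continuousAt_const.mul (h3.clm_apply continuousAt_const)).continuousWithinAt
  have := intervalIntegral.integral_eq_sub_of_hasDerivAt hder hcont.intervalIntegrable
  rw [intervalIntegral.integral_const_mul] at this
  simp only [L] at this ⊢
  simp at this ⊢
  linarith
end Hadamard

end SecPart1

section SecPart2
open Filter Topology Set

theorem lj_comp {E F G : Type*} [NormedAddCommGroup E] [NormedSpace ℝ E] [NormedAddCommGroup F]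
    [NormedSpace ℝ F] [NormedAddCommGroup G] [NormedSpace ℝ G] {g : F → G} {f : E → F}
    (hg : AnalyticAt ℝ g 0) (hf : AnalyticAt ℝ f 0) (h0 : f 0 = 0) :
    AnalyticAt ℝ (fun x => g (f x)) 0 :=
  AnalyticAt.comp (g := g) (f := f) (by rwa [h0]) hf

theorem lj_tendsto {E F : Type*} [NormedAddCommGroup E] [NormedSpace ℝ E] [NormedAddCommGroup F]
    [NormedSpace ℝ F] {f : E → F} (hf : AnalyticAt ℝ f 0) (h0 : f 0 = 0) :
    Tendsto f (𝓝 0) (𝓝 0) := by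
  simpa [h0] using hf.continuousAt.tendsto

theorem lj_mul_eq_zero {E : Type*} [NormedAddCommGroup E] [NormedSpace ℝ E] {F G : E → ℝ}
    (hF : AnalyticAt ℝ F 0) (hG : AnalyticAt ℝ G 0) (h : ∀ᶠ x in 𝓝 0, F x * G x = 0) :
    (∀ᶠ x in 𝓝 0, F x = 0) ∨ (∀ᶠ x in 𝓝 0, G x = 0) := by
  obtain ⟨ε, hε, hb⟩ := Metric.eventually_nhds_iff_ball.1
    (hF.eventually_analyticAt.and (hG.eventually_analyticAt.and h))
  by_cases hF0 : ∀ x ∈ Metric.ball (0:E) ε, F x = 0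
  · left
    filter_upwards [Metric.ball_mem_nhds (0:E) hε] with x hx using hF0 x hx
  · right
    push Not at hF0
    obtain ⟨x, hx, hFx⟩ := hF0
    have h1 : ∀ᶠ y in 𝓝 x, F y ≠ 0 := (hb x hx).1.continuousAt.eventually_ne hFx
    have h2 : G =ᶠ[𝓝 x] 0 := by
      filter_upwards [h1, Metric.isOpen_ball.mem_nhds hx] with y hy hy2
      exact (mul_eq_zero.1 (hb y hy2).2.2).resolve_left hy
    have h3 := AnalyticOnNhd.eqOn_zero_of_preconnected_of_eventuallyEq_zero
      (fun y hy => (hb y hy).2.1) (convex_ball (0:E) ε).isPreconnected hx h2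
    filter_upwards [Metric.ball_mem_nhds (0:E) hε] with y hy using h3 hy

theorem lj_mul_cancel {E : Type*} [NormedAddCommGroup E] [NormedSpace ℝ E] {F G H : E → ℝ}
    (hF : AnalyticAt ℝ F 0) (hG : AnalyticAt ℝ G 0) (hH : AnalyticAt ℝ H 0)
    (hF0 : ¬ ∀ᶠ x in 𝓝 0, F x = 0) (h : ∀ᶠ x in 𝓝 0, F x * G x = F x * H x) :
    ∀ᶠ x in 𝓝 0, G x = H x := by
  have := (lj_mul_eq_zero hF (hG.sub hH) (by
    filter_upwards [h] with x hx
    simp only [Pi.sub_apply, mul_sub, hx, sub_self])).resolve_left hF0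
  filter_upwards [this] with x hx using sub_eq_zero.1 hx

section DT
variable {E : Type*} [NormedAddCommGroup E] [NormedSpace ℝ E]

/-- derivative in the last variable -/
noncomputable def lj_dt (F : E × ℝ → ℝ) : E × ℝ → ℝ := fun p => fderiv ℝ F p (0, 1)

theorem lj_dt_analytic {F : E × ℝ → ℝ} {p : E × ℝ} (hF : AnalyticAt ℝ F p) : AnalyticAt ℝ (lj_dt F) p :=
  ((ContinuousLinearMap.apply ℝ ℝ ((0, 1) : E × ℝ)).analyticAt _).comp hF.fderiv

theorem lj_dt_iter_analytic {F : E × ℝ → ℝ} {p : E × ℝ} (hF : AnalyticAt ℝ F p) (k : ℕ) :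
    AnalyticAt ℝ (lj_dt^[k] F) p := by
  induction k with
  | zero => exact hF
  | succ k ih => rw [Function.iterate_succ_apply']; exact lj_dt_analytic ih

theorem lj_dt_congr {F G : E × ℝ → ℝ} {p : E × ℝ} (h : F =ᶠ[𝓝 p] G) : lj_dt F =ᶠ[𝓝 p] lj_dt G := by
  filter_upwards [h.fderiv (𝕜 := ℝ)] with x hx
  simp only [lj_dt, hx]

theorem lj_dt_iter_congr {F G : E × ℝ → ℝ} {p : E × ℝ} (h : F =ᶠ[𝓝 p] G) (k : ℕ) :
    lj_dt^[k] F =ᶠ[𝓝 p] lj_dt^[k] G := by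
  induction k with
  | zero => exact h
  | succ k ih => rw [Function.iterate_succ_apply', Function.iterate_succ_apply']; exact lj_dt_congr ih

theorem lj_dt_mul_t {G : E × ℝ → ℝ} (hG : AnalyticAt ℝ G 0) (k : ℕ) :
    lj_dt^[k+1] (fun p => p.2 * G p) =ᶠ[𝓝 0]
      fun p => p.2 * lj_dt^[k+1] G p + (k+1) * lj_dt^[k] G p := by
  have key : ∀ (A B : E × ℝ → ℝ) (c : ℝ), AnalyticAt ℝ A 0 → AnalyticAt ℝ B 0 →
      lj_dt (fun p => p.2 * A p + c * B p) =ᶠ[𝓝 0]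
        fun p => A p + p.2 * lj_dt A p + c * lj_dt B p := by
    intro A B c hA hB
    filter_upwards [hA.eventually_analyticAt, hB.eventually_analyticAt] with p hAp hBp
    have h1 : HasFDerivAt (fun p : E × ℝ => p.2) (ContinuousLinearMap.snd ℝ E ℝ) p := hasFDerivAt_snd
    have h := (h1.mul hAp.differentiableAt.hasFDerivAt).add
      (hBp.differentiableAt.hasFDerivAt.const_mul c)
    have h' : fderiv ℝ (fun p => p.2 * A p + c * B p) p = _ := h.fderiv
    simp only [lj_dt, h']
    simp
    ring
  induction k with
  | zero =>
    have := key G G 0 hG hG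
    simp only [zero_mul, add_zero] at this
    filter_upwards [this] with p hp
    simp [hp]; ring
  | succ k ih =>
    rw [Function.iterate_succ_apply']
    refine (lj_dt_congr ih).trans ?_
    filter_upwards [key _ _ ((k:ℝ)+1) (lj_dt_iter_analytic hG (k+1)) (lj_dt_iter_analytic hG k)] with p hp
    rw [hp, Function.iterate_succ_apply' lj_dt (k+1), Function.iterate_succ_apply' lj_dt k]
    push_cast; ring

theorem lj_tendsto_inl : Tendsto (fun x : E => ((x, 0) : E × ℝ)) (𝓝 0) (𝓝 0) := by
  have : Continuous (fun x : E => ((x, 0) : E × ℝ)) := by fun_prop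
  simpa [Prod.mk_zero_zero] using this.tendsto 0

theorem lj_tendsto_fst0 : Tendsto (fun p : E × ℝ => p.1) (𝓝 0) (𝓝 0) := by
  simpa using (continuous_fst (X := E) (Y := ℝ)).tendsto 0

theorem lj_taylor (d : ℕ) : ∀ {F : E × ℝ → ℝ}, AnalyticAt ℝ F 0 →
    ∃ G : E × ℝ → ℝ, AnalyticAt ℝ G 0 ∧ ∀ᶠ p in 𝓝 (0 : E × ℝ),
      F p = ∑ j ∈ Finset.range d, lj_dt^[j] F (p.1, 0) / (j.factorial : ℝ) * p.2 ^ j + p.2 ^ d * G p := by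
  induction d with
  | zero => intro F hF; exact ⟨F, hF, by simp⟩
  | succ d ih =>
    intro F hF
    obtain ⟨F1, hF1, h1⟩ := lj_hadamard F hF (ContinuousLinearMap.snd ℝ E ℝ) (0, 1)
    obtain ⟨G, hG, h2⟩ := ih hF1
    refine ⟨G, hG, ?_⟩
    have h1' : F =ᶠ[𝓝 0] fun p => F (p.1, 0) + p.2 * F1 p := by
      filter_upwards [h1] with p hp
      have e : p - (ContinuousLinearMap.snd ℝ E ℝ) p • ((0, 1) : E × ℝ) = (p.1, 0) := by
        ext <;> simp
      rw [hp, e]; simp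
    have hinl : AnalyticAt ℝ (fun p : E × ℝ => F (p.1, 0)) 0 := by
      have : AnalyticAt ℝ (fun p : E × ℝ => ((p.1, 0) : E × ℝ)) 0 := analyticAt_fst.prod analyticAt_const
      exact AnalyticAt.comp (g := F) (f := fun p : E × ℝ => ((p.1, 0) : E × ℝ)) (by simpa [Prod.mk_zero_zero] using hF) this
    have hd : lj_dt F =ᶠ[𝓝 0] lj_dt (fun p => p.2 * F1 p) := by
      refine (lj_dt_congr h1').trans ?_
      have hinl2 : ∀ᶠ p in 𝓝 (0 : E × ℝ), AnalyticAt ℝ F (p.1, 0) :=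
        (lj_tendsto_inl.comp lj_tendsto_fst0).eventually hF.eventually_analyticAt
      filter_upwards [hinl2, hF1.eventually_analyticAt] with p hp hp1
      have e1 : HasFDerivAt (fun p : E × ℝ => F (p.1, 0))
          ((fderiv ℝ F (p.1, 0)).comp ((ContinuousLinearMap.inl ℝ E ℝ).comp (ContinuousLinearMap.fst ℝ E ℝ))) p :=
        HasFDerivAt.comp (g := F) (f := fun p : E × ℝ => ((p.1, 0) : E × ℝ)) p
          hp.differentiableAt.hasFDerivAt
          ((ContinuousLinearMap.inl ℝ E ℝ).comp (ContinuousLinearMap.fst ℝ E ℝ)).hasFDerivAt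
      have e2 : DifferentiableAt ℝ (fun p : E × ℝ => p.2 * F1 p) p :=
        differentiableAt_snd.mul hp1.differentiableAt
      have e3 : fderiv ℝ (fun p : E × ℝ => F (p.1, 0) + p.2 * F1 p) p = _ := (e1.add e2.hasFDerivAt).fderiv
      simp only [lj_dt, e3]
      simp [Prod.mk_zero_zero]
    have hco : ∀ j, ∀ᶠ p in 𝓝 (0 : E × ℝ), lj_dt^[j+1] F (p.1, 0) = (j+1) * lj_dt^[j] F1 (p.1, 0) := by
      intro j
      have e : lj_dt^[j+1] F =ᶠ[𝓝 0] lj_dt^[j+1] (fun p => p.2 * F1 p) := by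
        rw [Function.iterate_succ_apply, Function.iterate_succ_apply]
        exact lj_dt_iter_congr hd j
      have e' := e.trans (lj_dt_mul_t hF1 j)
      filter_upwards [(lj_tendsto_inl.comp lj_tendsto_fst0).eventually e'] with p hp
      simpa using hp
    have hco' : ∀ᶠ p in 𝓝 (0 : E × ℝ), ∀ j ∈ Finset.range d,
        lj_dt^[j+1] F (p.1, 0) = (j+1) * lj_dt^[j] F1 (p.1, 0) :=
      (Finset.eventually_all _).2 fun j _ => hco j
    filter_upwards [h1', h2, hco'] with p hp1 hp2 hp3
    rw [Finset.sum_range_succ', hp1, hp2]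
    simp only [Function.iterate_zero, id, Nat.factorial_zero, Nat.cast_one, pow_zero]
    have : ∑ k ∈ Finset.range d, lj_dt^[k+1] F (p.1, 0) / ((k+1).factorial : ℝ) * p.2 ^ (k+1)
        = p.2 * ∑ j ∈ Finset.range d, lj_dt^[j] F1 (p.1, 0) / (j.factorial : ℝ) * p.2 ^ j := by
      rw [Finset.mul_sum]
      refine Finset.sum_congr rfl fun j hj => ?_
      rw [hp3 j hj, Nat.factorial_succ]
      push_cast
      have : (j.factorial : ℝ) ≠ 0 := by positivity
      field_simp
      ring
    rw [this]; ring

theorem lj_dt_shift {F : E × ℝ → ℝ} (hF : AnalyticAt ℝ F 0) {φ : E → ℝ} (hφ : AnalyticAt ℝ φ 0)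
    (hφ0 : φ 0 = 0) (k : ℕ) :
    lj_dt^[k] (fun p => F (p.1, p.2 + φ p.1)) =ᶠ[𝓝 0] fun p => lj_dt^[k] F (p.1, p.2 + φ p.1) := by
  have hφ1 : AnalyticAt ℝ (fun p : E × ℝ => φ p.1) 0 :=
    AnalyticAt.comp (g := φ) (f := fun p : E × ℝ => p.1) (by simpa using hφ) analyticAt_fst
  have hρ : AnalyticAt ℝ (fun p : E × ℝ => (p.1, p.2 + φ p.1)) 0 :=
    analyticAt_fst.prod (analyticAt_snd.add hφ1)
  have hρt : Tendsto (fun p : E × ℝ => (p.1, p.2 + φ p.1)) (𝓝 0) (𝓝 0) := by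
    simpa [hφ0, Prod.mk_zero_zero] using hρ.continuousAt.tendsto
  induction k with
  | zero => exact EventuallyEq.rfl
  | succ k ih =>
    rw [Function.iterate_succ_apply', Function.iterate_succ_apply']
    refine (lj_dt_congr ih).trans ?_
    have h1 := hρt.eventually (lj_dt_iter_analytic hF k).eventually_analyticAt
    have hφev := lj_tendsto_fst0.eventually hφ.eventually_analyticAt
    filter_upwards [h1, hφev] with p hp hφp
    have e1 : HasFDerivAt (fun p : E × ℝ => φ p.1) ((fderiv ℝ φ p.1).comp (ContinuousLinearMap.fst ℝ E ℝ)) p :=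
      HasFDerivAt.comp (g := φ) (f := fun p : E × ℝ => p.1) p hφp.differentiableAt.hasFDerivAt hasFDerivAt_fst
    have e2 := HasFDerivAt.prodMk (hasFDerivAt_fst (𝕜 := ℝ) (p := p)) ((hasFDerivAt_snd (𝕜 := ℝ) (p := p)).add e1)
    have e3 : fderiv ℝ (fun p : E × ℝ => lj_dt^[k] F (p.1, p.2 + φ p.1)) p = _ :=
      (HasFDerivAt.comp (g := lj_dt^[k] F) (f := fun p : E × ℝ => (p.1, p.2 + φ p.1)) p
        hp.differentiableAt.hasFDerivAt e2).fderiv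
    simp only [lj_dt, e3]
    simp

/-- a nonzero restriction to the line gives a nonzero derivative -/
theorem lj_exists_reg {F : E × ℝ → ℝ} (hF : AnalyticAt ℝ F 0)
    (h : ¬ ∀ᶠ t in 𝓝 (0:ℝ), F (0, t) = 0) : ∃ d, lj_dt^[d] F 0 ≠ 0 := by
  have hq : AnalyticAt ℝ (fun t : ℝ => F (0, t)) 0 := by
    have : AnalyticAt ℝ (fun t : ℝ => ((0, t) : E × ℝ)) 0 := analyticAt_const.prod analyticAt_id
    exact AnalyticAt.comp (g := F) (f := fun t : ℝ => ((0, t) : E × ℝ)) (by simpa [Prod.mk_zero_zero] using hF) this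
  obtain ⟨d, w, hw, hw0, hqw⟩ := (hq.exists_eventuallyEq_pow_smul_nonzero_iff).2 h
  by_contra hcon
  push Not at hcon
  obtain ⟨G, hG, hT⟩ := lj_taylor (d+1) hF
  have hin : Tendsto (fun t : ℝ => ((0, t) : E × ℝ)) (𝓝 0) (𝓝 0) := by
    have : Continuous (fun t : ℝ => ((0, t) : E × ℝ)) := by fun_prop
    simpa [Prod.mk_zero_zero] using this.tendsto 0
  have hcon' : ∀ k, lj_dt^[k] F ((0:E), (0:ℝ)) = 0 := hcon
  have hG0 : Tendsto (fun t : ℝ => t * G (0, t)) (𝓝[≠] 0) (𝓝 0) := by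
    have : Tendsto (fun t : ℝ => t * G (0, t)) (𝓝 0) (𝓝 (0 * G 0)) :=
      tendsto_id.mul (hG.continuousAt.tendsto.comp hin)
    rw [zero_mul] at this
    exact this.mono_left nhdsWithin_le_nhds
  have heq : (fun t : ℝ => t * G (0, t)) =ᶠ[𝓝[≠] 0] w := by
    filter_upwards [nhdsWithin_le_nhds (hin.eventually hT), nhdsWithin_le_nhds hqw, self_mem_nhdsWithin] with t h1 h2 ht
    simp only [hcon', zero_div, zero_mul, Finset.sum_const_zero, zero_add] at h1
    rw [h1, sub_zero, smul_eq_mul, pow_succ, mul_assoc] at h2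
    exact mul_left_cancel₀ (pow_ne_zero d ht) h2
  exact hw0 (tendsto_nhds_unique (hw.continuousAt.tendsto.mono_left nhdsWithin_le_nhds) (hG0.congr' heq))

end DT

theorem lj_poly_coeff (d : ℕ) : ∀ (p : Polynomial ℝ) (g : ℝ → ℝ), ContinuousAt g 0 →
    (∀ᶠ s in 𝓝[≠] (0:ℝ), p.eval s = s ^ d * g s) → ∀ k < d, p.coeff k = 0 := by
  induction d with
  | zero => intro p g _ _ k hk; omega
  | succ d ih =>
    intro p g hg h
    have h0 : p.coeff 0 = 0 := by
      have t1 : Tendsto (fun s => p.eval s) (𝓝[≠] 0) (𝓝 (p.eval 0)) :=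
        (p.continuous.tendsto 0).mono_left nhdsWithin_le_nhds
      have t2 : Tendsto (fun s : ℝ => s ^ (d+1) * g s) (𝓝[≠] 0) (𝓝 (0 ^ (d+1) * g 0)) :=
        (((continuous_pow (d+1)).tendsto (0:ℝ)).mul hg.tendsto).mono_left nhdsWithin_le_nhds
      have := tendsto_nhds_unique t1 (t2.congr' (by filter_upwards [h] with s hs using hs.symm))
      rw [Polynomial.coeff_zero_eq_eval_zero, this]; simp
    have hp : p = Polynomial.X * p.divX := by
      conv_lhs => rw [← Polynomial.divX_mul_X_add p, h0]
      simp [mul_comm]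
    have := ih p.divX g hg (by
      filter_upwards [h, self_mem_nhdsWithin] with s hs hs0
      rw [hp] at hs
      simp only [Polynomial.eval_mul, Polynomial.eval_X, pow_succ] at hs
      have hs0' : s ≠ 0 := hs0
      apply mul_left_cancel₀ hs0'
      rw [hs]; ring)
    intro k hk
    cases k with
    | zero => exact h0
    | succ k => rw [← Polynomial.coeff_divX]; exact this k (by omega)

end SecPart2

section SecPart3
open Filter Topology Set

section Mon
variable {E : Type*} [NormedAddCommGroup E] [NormedSpace ℝ E] {ι : Type*} [Fintype ι]

def lj_Mon (ξ : ι → E → ℝ) (F : E → ℝ) : Prop :=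
  ∃ (α : ι → ℕ) (u : E → ℝ), AnalyticAt ℝ u 0 ∧ u 0 ≠ 0 ∧
    F =ᶠ[𝓝 0] fun z => (∏ i, ξ i z ^ α i) * u z

theorem lj_Mon.congr {ξ : ι → E → ℝ} {F G : E → ℝ} (hF : lj_Mon ξ F) (h : G =ᶠ[𝓝 0] F) :
    lj_Mon ξ G := by
  obtain ⟨α, u, hu, hu0, hF⟩ := hF
  exact ⟨α, u, hu, hu0, h.trans hF⟩

theorem lj_Mon.unit (ξ : ι → E → ℝ) {u : E → ℝ} (hu : AnalyticAt ℝ u 0) (hu0 : u 0 ≠ 0) :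
    lj_Mon ξ u := ⟨0, u, hu, hu0, by simp⟩

theorem lj_Mon.coord [DecidableEq ι] (ξ : ι → E → ℝ) (i : ι) : lj_Mon ξ (ξ i) := by
  refine ⟨Pi.single i 1, fun _ => 1, analyticAt_const, one_ne_zero, Eventually.of_forall fun z => ?_⟩
  simp only [mul_one]
  rw [Finset.prod_eq_single i]
  · simp
  · intro j _ hj; simp [hj]
  · simp

theorem lj_Mon.mul {ξ : ι → E → ℝ} {F G : E → ℝ} (hF : lj_Mon ξ F) (hG : lj_Mon ξ G) :
    lj_Mon ξ (fun z => F z * G z) := by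
  obtain ⟨α, u, hu, hu0, hF⟩ := hF
  obtain ⟨β, v, hv, hv0, hG⟩ := hG
  refine ⟨α + β, fun z => u z * v z, hu.mul hv, mul_ne_zero hu0 hv0, ?_⟩
  filter_upwards [hF, hG] with z h1 h2
  rw [h1, h2]
  simp only [Pi.add_apply, pow_add, Finset.prod_mul_distrib]
  ring

theorem lj_Mon.pow {ξ : ι → E → ℝ} {F : E → ℝ} (hF : lj_Mon ξ F) (k : ℕ) :
    lj_Mon ξ (fun z => F z ^ k) := by
  induction k with
  | zero => simpa using lj_Mon.unit ξ (u := fun _ => (1:ℝ)) analyticAt_const one_ne_zero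
  | succ k ih => simpa [pow_succ] using ih.mul hF

theorem lj_Mon.prod {κ : Type*} {ξ : ι → E → ℝ} (s : Finset κ) {F : κ → E → ℝ}
    (hF : ∀ k ∈ s, lj_Mon ξ (F k)) :
    lj_Mon ξ (fun z => ∏ k ∈ s, F k z) := by
  classical
  induction s using Finset.induction_on with
  | empty => simpa using lj_Mon.unit ξ (u := fun _ => (1:ℝ)) analyticAt_const one_ne_zero
  | insert a s ha ih =>
    have := (hF a (Finset.mem_insert_self _ _)).mul
      (ih (fun k hk => hF k (Finset.mem_insert_of_mem hk)))
    refine this.congr (Eventually.of_forall fun z => ?_)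
    exact Finset.prod_insert ha

/-- Transport of a monomial form through a map under which coordinates become monomials. -/
theorem lj_Mon.comp {E' : Type*} [NormedAddCommGroup E'] [NormedSpace ℝ E'] {κ : Type*} [Fintype κ]
    {ξ : ι → E → ℝ} {η : κ → E' → ℝ} {F : E → ℝ} (hF : lj_Mon ξ F) {π : E' → E}
    (hπ : AnalyticAt ℝ π 0) (hπ0 : π 0 = 0) (h : ∀ i, lj_Mon η (fun y => ξ i (π y))) :
    lj_Mon η (fun y => F (π y)) := by
  obtain ⟨α, u, hu, hu0, hF⟩ := hF
  have h1 := (lj_Mon.prod Finset.univ (fun i _ => (h i).pow (α i))).mul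
    (lj_Mon.unit η (lj_comp hu hπ hπ0) (by simpa [hπ0] using hu0))
  refine h1.congr ?_
  filter_upwards [(lj_tendsto hπ hπ0).eventually hF] with y hy
  exact hy
end Mon

section Pi
variable {n : ℕ}

def lj_mono (δ : Fin n → ℕ) (z : Fin n → ℝ) : ℝ := ∏ i, z i ^ δ i

def lj_xi (n : ℕ) : Fin n → (Fin n → ℝ) → ℝ := fun i z => z i

theorem lj_coord_analytic (i : Fin n) (x : Fin n → ℝ) : AnalyticAt ℝ (fun z : Fin n → ℝ => z i) x :=
  (ContinuousLinearMap.proj (R := ℝ) (φ := fun _ : Fin n => ℝ) i).analyticAt x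

theorem lj_mono_analytic (δ : Fin n → ℕ) (x : Fin n → ℝ) : AnalyticAt ℝ (lj_mono δ) x := by
  unfold lj_mono
  have := Finset.analyticAt_fun_prod (𝕜 := ℝ) (f := fun (i : Fin n) (z : Fin n → ℝ) => z i ^ δ i) Finset.univ
    (fun i _ => (lj_coord_analytic i x).pow (δ i))
  exact this

theorem lj_mono_continuous (δ : Fin n → ℕ) : Continuous (lj_mono δ) := by
  unfold lj_mono; fun_prop

theorem lj_mono_add_single (δ : Fin n → ℕ) (i : Fin n) (z : Fin n → ℝ) :
    lj_mono (δ + Pi.single i 1) z = z i * lj_mono δ z := by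
  unfold lj_mono
  simp only [Pi.add_apply, pow_add, Finset.prod_mul_distrib]
  rw [mul_comm]
  congr 1
  rw [Finset.prod_eq_single i]
  · simp
  · intro j _ hj; simp [hj]
  · simp

theorem lj_mono_ne (δ : Fin n → ℕ) : ¬ ∀ᶠ z in 𝓝 (0 : Fin n → ℝ), lj_mono δ z = 0 := by
  intro h
  have ht : Tendsto (fun s : ℝ => (fun _ : Fin n => s)) (𝓝[≠] 0) (𝓝 0) := by
    have : Continuous (fun s : ℝ => (fun _ : Fin n => s)) := by fun_prop
    exact (this.tendsto 0).mono_left nhdsWithin_le_nhds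
  have h1 := (ht.eventually h).and (eventually_mem_nhdsWithin (a := (0:ℝ)))
  obtain ⟨s, hs, hs0⟩ := h1.exists
  exact (Finset.prod_ne_zero_iff.2 fun i _ => pow_ne_zero _ hs0) hs

theorem lj_coord_ne (i : Fin n) : ¬ ∀ᶠ z in 𝓝 (0 : Fin n → ℝ), z i = 0 := by
  have := lj_mono_ne (Pi.single i 1 : Fin n → ℕ)
  have h2 : ∀ z, lj_mono (Pi.single i 1) z = z i := fun z => by
    have := lj_mono_add_single (0 : Fin n → ℕ) i z
    rw [zero_add] at this
    rw [this]; simp [lj_mono]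
  simpa only [h2] using this

theorem lj_split (δ : Fin n → ℕ) (i : Fin n) (h : 0 < δ i) :
    ∃ δ' : Fin n → ℕ, δ = δ' + Pi.single i 1 ∧ ∑ j, δ j = ∑ j, δ' j + 1 := by
  refine ⟨δ - Pi.single i 1, ?_⟩
  have h1 : δ = δ - Pi.single i 1 + Pi.single i 1 := by
    ext j
    by_cases hj : j = i
    · subst hj; simp; omega
    · simp [hj]
  refine ⟨h1, ?_⟩
  conv_lhs => rw [h1]
  simp [Finset.sum_add_distrib]

theorem lj_split' (δ : Fin n → ℕ) {N : ℕ} (h : ∑ j, δ j = N + 1) :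
    ∃ (i : Fin n) (δ' : Fin n → ℕ), δ = δ' + Pi.single i 1 ∧ ∑ j, δ' j = N := by
  have : ∃ i, 0 < δ i := by
    by_contra hcon
    push Not at hcon
    have : ∑ j, δ j = 0 := Finset.sum_eq_zero fun j _ => Nat.le_zero.1 (hcon j)
    omega
  obtain ⟨i, hi⟩ := this
  obtain ⟨δ', h1, h2⟩ := lj_split δ i hi
  exact ⟨i, δ', h1, by omega⟩

theorem lj_zero_of_sum (δ : Fin n → ℕ) (h : ∑ j, δ j = 0) : δ = 0 := by
  ext j; exact (Finset.sum_eq_zero_iff.1 h) j (Finset.mem_univ _)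

theorem lj_had_coord {F : (Fin n → ℝ) → ℝ} (hF : AnalyticAt ℝ F 0) (i : Fin n)
    (h : ∀ᶠ z in 𝓝 (0 : Fin n → ℝ), F (z - z i • Pi.single i 1) = 0) :
    ∃ G : (Fin n → ℝ) → ℝ, AnalyticAt ℝ G 0 ∧ ∀ᶠ z in 𝓝 (0 : Fin n → ℝ), F z = z i * G z := by
  obtain ⟨G, hG, hFG⟩ := lj_hadamard F hF (ContinuousLinearMap.proj (R := ℝ) (φ := fun _ : Fin n => ℝ) i)
    (Pi.single i 1)
  refine ⟨G, hG, ?_⟩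
  filter_upwards [hFG, h] with z h1 h2
  rw [h1]
  simp only [ContinuousLinearMap.proj_apply]
  rw [h2, zero_add]

theorem lj_P_analytic (i : Fin n) : AnalyticAt ℝ (fun z : Fin n → ℝ => z - z i • (Pi.single i 1 : Fin n → ℝ)) 0 :=
  analyticAt_id.sub ((lj_coord_analytic i 0).smul analyticAt_const)

theorem lj_P_tendsto (i : Fin n) :
    Tendsto (fun z : Fin n → ℝ => z - z i • (Pi.single i 1 : Fin n → ℝ)) (𝓝 0) (𝓝 0) :=
  lj_tendsto (lj_P_analytic i) (by simp)

theorem lj_le_extend {A B : (Fin n → ℝ) → ℝ} (hA : ∀ᶠ z in 𝓝 (0 : Fin n → ℝ), ContinuousAt A z)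
    (hB : ∀ᶠ z in 𝓝 (0 : Fin n → ℝ), ContinuousAt B z) (i : Fin n)
    (h : ∀ᶠ z in 𝓝 (0 : Fin n → ℝ), z i ≠ 0 → A z ≤ B z) :
    ∀ᶠ z in 𝓝 (0 : Fin n → ℝ), A z ≤ B z := by
  filter_upwards [hA, hB, h, h.eventually_nhds] with z h1 h2 h3 h4
  by_cases hz : z i = 0
  · have hc : Continuous (fun s : ℝ => z + s • (Pi.single i 1 : Fin n → ℝ)) := by fun_prop
    have ht : Tendsto (fun s : ℝ => z + s • (Pi.single i 1 : Fin n → ℝ)) (𝓝[≠] 0) (𝓝 z) := by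
      have := (hc.tendsto 0).mono_left (nhdsWithin_le_nhds (s := {0}ᶜ))
      simpa using this
    refine le_of_tendsto_of_tendsto (h1.tendsto.comp ht) (h2.tendsto.comp ht) ?_
    filter_upwards [ht.eventually h4, eventually_mem_nhdsWithin] with s hs hs0
    apply hs
    simpa [hz] using hs0
  · exact h3 hz

theorem lj_div_mono (N : ℕ) : ∀ (δ : Fin n → ℕ), ∑ j, δ j = N → ∀ {F : (Fin n → ℝ) → ℝ},
    AnalyticAt ℝ F 0 → ∀ C : ℝ, (∀ᶠ z in 𝓝 (0 : Fin n → ℝ), |F z| ≤ C * |lj_mono δ z|) →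
    ∃ G : (Fin n → ℝ) → ℝ, AnalyticAt ℝ G 0 ∧ ∀ᶠ z in 𝓝 (0 : Fin n → ℝ), F z = lj_mono δ z * G z := by
  induction N with
  | zero =>
    intro δ hδ F hF C _
    obtain rfl := lj_zero_of_sum δ hδ
    exact ⟨F, hF, by simp [lj_mono]⟩
  | succ N ih =>
    intro δ hδ F hF C hC
    obtain ⟨i, δ', rfl, hδ'⟩ := lj_split' δ hδ
    obtain ⟨G, hG, hFG⟩ := lj_had_coord hF i (by
      filter_upwards [(lj_P_tendsto i).eventually hC] with z hz
      rw [lj_mono_add_single] at hz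
      simpa using hz)
    obtain ⟨G', hG', hGG⟩ := ih δ' hδ' hG C (by
      refine lj_le_extend ?_ ?_ i ?_
      · filter_upwards [hG.eventually_analyticAt] with z hz
        exact hz.continuousAt.abs
      · exact Eventually.of_forall fun z => by
          have := (lj_mono_continuous δ').continuousAt (x := z)
          fun_prop
      · filter_upwards [hC, hFG] with z h1 h2 hz
        rw [h2, lj_mono_add_single, abs_mul, abs_mul] at h1
        have := abs_pos.2 hz
        nlinarith)
    refine ⟨G', hG', ?_⟩
    filter_upwards [hFG, hGG] with z h1 h2
    rw [h1, h2, lj_mono_add_single, mul_assoc]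

theorem lj_Mon_of_mul_aux (N : ℕ) : ∀ (γ : Fin n → ℕ), ∑ j, γ j = N → ∀ {F G u : (Fin n → ℝ) → ℝ},
    AnalyticAt ℝ F 0 → AnalyticAt ℝ G 0 → AnalyticAt ℝ u 0 → u 0 ≠ 0 →
    (∀ᶠ z in 𝓝 (0 : Fin n → ℝ), F z * G z = lj_mono γ z * u z) → lj_Mon (lj_xi n) F := by
  induction N with
  | zero =>
    intro γ hγ F G u hF hG hu hu0 h
    obtain rfl := lj_zero_of_sum γ hγ
    have h0 := h.self_of_nhds
    simp only [lj_mono, Pi.zero_apply, pow_zero, Finset.prod_const_one, one_mul] at h0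
    exact lj_Mon.unit _ hF (left_ne_zero_of_mul (h0 ▸ hu0))
  | succ N ih =>
    intro γ hγ F G u hF hG hu hu0 h
    obtain ⟨i, γ', rfl, hγ'⟩ := lj_split' γ hγ
    simp only [lj_mono_add_single] at h
    have hP : ∀ᶠ z in 𝓝 (0 : Fin n → ℝ), F (z - z i • (Pi.single i 1 : Fin n → ℝ)) *
        G (z - z i • (Pi.single i 1 : Fin n → ℝ)) = 0 := by
      filter_upwards [(lj_P_tendsto i).eventually h] with z hz
      simpa using hz
    have hR : AnalyticAt ℝ (fun z => lj_mono γ' z * u z) 0 := (lj_mono_analytic γ' 0).mul hu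
    rcases lj_mul_eq_zero (lj_comp hF (lj_P_analytic i) (by simp))
      (lj_comp hG (lj_P_analytic i) (by simp)) hP with h0 | h0
    · obtain ⟨F1, hF1, hFF⟩ := lj_had_coord hF i h0
      have h2 := lj_mul_cancel (lj_coord_analytic i 0) (hF1.mul hG) hR (lj_coord_ne i) (by
        filter_upwards [h, hFF] with z h1 h2
        rw [h2] at h1
        simp only [Pi.mul_apply]; linarith)
      have := ih γ' hγ' hF1 hG hu hu0 h2
      exact ((lj_Mon.coord (lj_xi n) i).mul this).congr hFF
    · obtain ⟨G1, hG1, hGG⟩ := lj_had_coord hG i h0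
      have h2 := lj_mul_cancel (lj_coord_analytic i 0) (hF.mul hG1) hR (lj_coord_ne i) (by
        filter_upwards [h, hGG] with z h1 h2
        rw [h2] at h1
        simp only [Pi.mul_apply]; linarith)
      exact ih γ' hγ' hF hG1 hu hu0 h2

theorem lj_Mon_of_mul {F G : (Fin n → ℝ) → ℝ} (hF : AnalyticAt ℝ F 0) (hG : AnalyticAt ℝ G 0)
    (h : lj_Mon (lj_xi n) (fun z => F z * G z)) : lj_Mon (lj_xi n) F := by
  obtain ⟨γ, u, hu, hu0, h⟩ := h
  exact lj_Mon_of_mul_aux _ γ rfl hF hG hu hu0 h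

theorem lj_Mon_ne {F : (Fin n → ℝ) → ℝ} (h : lj_Mon (lj_xi n) F) :
    ¬ ∀ᶠ z in 𝓝 (0 : Fin n → ℝ), F z = 0 := by
  obtain ⟨γ, u, hu, hu0, h⟩ := h
  intro h0
  refine lj_mono_ne γ ?_
  filter_upwards [h, h0, hu.continuousAt.eventually_ne hu0] with z h1 h2 h3
  rw [h2] at h1
  exact (mul_eq_zero.1 h1.symm).resolve_right h3
end Pi

end SecPart3

section SecPart4
open Filter Topology Set

section Unif
variable {A : Type*} {E E' E'' : Type*} [NormedAddCommGroup E] [NormedSpace ℝ E]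
  [NormedAddCommGroup E'] [NormedSpace ℝ E'] [NormedAddCommGroup E''] [NormedSpace ℝ E'']
  {κ : Type*} [Fintype κ]

def lj_Unif (l : Filter A) (η : κ → E' → ℝ) (F : E → ℝ) (x : A → E) : Prop :=
  ∃ (π : E' → E) (y : A → E'), AnalyticAt ℝ π 0 ∧ π 0 = 0 ∧ Tendsto y l (𝓝 0) ∧
    (∀ᶠ a in l, x a = π (y a)) ∧ lj_Mon η (fun z => F (π z))

theorem lj_Unif.comp {l : Filter A} {η : κ → E' → ℝ} {F : E → ℝ} {x : A → E} {ρ : E'' → E} {x' : A → E''}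
    (hρ : AnalyticAt ℝ ρ 0) (hρ0 : ρ 0 = 0) (hx : ∀ᶠ a in l, x a = ρ (x' a))
    (h : lj_Unif l η (fun w => F (ρ w)) x') : lj_Unif l η F x := by
  obtain ⟨π, y, hπ, hπ0, hy, hxy, hM⟩ := h
  refine ⟨fun z => ρ (π z), y, lj_comp hρ hπ hπ0, by simp [hπ0, hρ0], hy, ?_, hM⟩
  filter_upwards [hx, hxy] with a h1 h2
  rw [h1, h2]

theorem lj_Unif.congr {l : Filter A} {η : κ → E' → ℝ} {F G : E → ℝ} {x : A → E}
    (h : lj_Unif l η F x) (hFG : ∀ᶠ w in 𝓝 0, G w = F w) : lj_Unif l η G x := by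
  obtain ⟨π, y, hπ, hπ0, hy, hxy, hM⟩ := h
  exact ⟨π, y, hπ, hπ0, hy, hxy, hM.congr ((lj_tendsto hπ hπ0).eventually hFG)⟩

theorem lj_Unif.mul_unit {l : Filter A} {η : κ → E' → ℝ} {F u : E → ℝ} {x : A → E}
    (h : lj_Unif l η F x) (hu : AnalyticAt ℝ u 0) (hu0 : u 0 ≠ 0) :
    lj_Unif l η (fun w => F w * u w) x := by
  obtain ⟨π, y, hπ, hπ0, hy, hxy, hM⟩ := h
  exact ⟨π, y, hπ, hπ0, hy, hxy, hM.mul (lj_Mon.unit _ (lj_comp hu hπ hπ0) (by simpa [hπ0] using hu0))⟩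

theorem lj_dichotomy (l : Ultrafilter A) (a b : A → ℝ) :
    (∃ c, Tendsto (fun i => a i / b i) l (𝓝 c) ∧ ∀ᶠ i in (l : Filter A), a i = b i * (a i / b i)) ∨
    (Tendsto (fun i => b i / a i) l (𝓝 0) ∧ ∀ᶠ i in (l : Filter A), a i ≠ 0) := by
  by_cases h : ∃ K : ℝ, ∀ᶠ i in (l : Filter A), |a i| ≤ K * |b i|
  · left
    obtain ⟨K, hK⟩ := h
    have hK' : ∀ᶠ i in (l : Filter A), a i / b i ∈ Icc (-|K|) |K| := by
      filter_upwards [hK] with i hi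
      rw [mem_Icc, ← abs_le, abs_div]
      apply div_le_of_le_mul₀ (abs_nonneg _) (abs_nonneg _)
      exact hi.trans (mul_le_mul_of_nonneg_right (le_abs_self K) (abs_nonneg _))
    obtain ⟨c, _, hc⟩ := (isCompact_Icc (a := -|K|) (b := |K|)).ultrafilter_le_nhds
      (l.map fun i => a i / b i) (by rw [le_principal_iff]; exact hK')
    refine ⟨c, hc, ?_⟩
    filter_upwards [hK] with i hi
    by_cases hb : b i = 0
    · simpa [hb] using hi
    · field_simp
  · right
    push Not at h
    have h' := h
    constructor
    · rw [Metric.tendsto_nhds]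
      intro ε hε
      filter_upwards [h' (1/ε)] with i hi
      have ha : 0 < |a i| := lt_of_le_of_lt (by positivity) hi
      rw [dist_zero_right, Real.norm_eq_abs, abs_div, div_lt_iff₀ ha]
      rw [div_mul_eq_mul_div, one_mul, div_lt_iff₀ hε] at hi
      linarith
    · filter_upwards [h' 0] with i hi
      simpa using hi
end Unif

section LemmaM
variable {n : ℕ} {A : Type*}

def lj_eta (n : ℕ) : Option (Fin n) → ((Fin n → ℝ) × ℝ) → ℝ
  | none => fun p => p.2
  | some i => fun p => p.1 i

theorem lj_eta_snd : lj_Mon (lj_eta n) (fun p => p.2) := lj_Mon.coord (lj_eta n) none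
theorem lj_eta_fst (i : Fin n) : lj_Mon (lj_eta n) (fun p => p.1 i) := lj_Mon.coord (lj_eta n) (some i)

theorem lj_an_fst (i : Fin n) : AnalyticAt ℝ (fun p : (Fin n → ℝ) × ℝ => p.1 i) 0 :=
  lj_comp (g := fun z : Fin n → ℝ => z i) (f := fun p : (Fin n → ℝ) × ℝ => p.1)
    (lj_coord_analytic i 0) analyticAt_fst rfl

theorem lj_an_mono (γ : Fin n → ℕ) : AnalyticAt ℝ (fun p : (Fin n → ℝ) × ℝ => lj_mono γ p.1) 0 :=
  lj_comp (f := fun p : (Fin n → ℝ) × ℝ => p.1)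
    (lj_mono_analytic γ 0) analyticAt_fst rfl

theorem lj_lemmaM (l : Ultrafilter A) (N : ℕ) : ∀ (γ : Fin n → ℕ), ∑ j, γ j = N →
    ∀ q : A → (Fin n → ℝ) × ℝ, Tendsto q l (𝓝 0) → (∀ᶠ a in (l : Filter A), (q a).2 ≠ 0) →
    Tendsto (fun a => lj_mono γ (q a).1 / (q a).2) l (𝓝 0) →
    ∃ (π : (Fin n → ℝ) × ℝ → (Fin n → ℝ) × ℝ) (y : A → (Fin n → ℝ) × ℝ) (G : (Fin n → ℝ) × ℝ → ℝ),
      AnalyticAt ℝ π 0 ∧ π 0 = 0 ∧ Tendsto y l (𝓝 0) ∧ (∀ᶠ a in (l : Filter A), q a = π (y a)) ∧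
      lj_Mon (lj_eta n) (fun p => (π p).2) ∧ (∀ i, lj_Mon (lj_eta n) (fun p => (π p).1 i)) ∧
      AnalyticAt ℝ G 0 ∧ G 0 = 0 ∧ ∀ᶠ p in 𝓝 0, lj_mono γ (π p).1 = (π p).2 * G p := by
  induction N with
  | zero =>
    intro γ hγ q hq hq0 ht
    exfalso
    obtain rfl := lj_zero_of_sum γ hγ
    have h2 : Tendsto (fun a => (q a).2) l (𝓝 0) := (continuous_snd.tendsto 0).comp hq
    have h3 := ht.mul h2
    have h4 : Tendsto (fun _ : A => (1:ℝ)) l (𝓝 (0 * 0)) := by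
      refine h3.congr' ?_
      filter_upwards [hq0] with a ha
      simp [lj_mono, ha]
    have := tendsto_nhds_unique h4 tendsto_const_nhds
    norm_num at this
  | succ N ih =>
    intro γ hγ q hq hq0 ht
    obtain ⟨i, γ', rfl, hγ'⟩ := lj_split' γ hγ
    have hq1 : Tendsto (fun a => (q a).1) l (𝓝 0) := (continuous_fst.tendsto 0).comp hq
    have hq2 : Tendsto (fun a => (q a).2) l (𝓝 0) := (continuous_snd.tendsto 0).comp hq
    simp only [lj_mono_add_single] at ht ⊢
    rcases lj_dichotomy l (fun a => (q a).2) (fun a => (q a).1 i) with ⟨c, hc, hc'⟩ | ⟨hc, hc'⟩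
    · have hqi : ∀ᶠ a in (l : Filter A), (q a).1 i ≠ 0 := by
        filter_upwards [hc', hq0] with a h1 h2 h3
        rw [h3, zero_mul] at h1; exact h2 h1
      by_cases hc0 : c = 0
      · subst hc0
        obtain ⟨π, y, G, hπ, hπ0, hy, hqy, hM1, hM2, hG, hG0, hGe⟩ := ih γ' hγ'
          (fun a => ((q a).1, (q a).2 / (q a).1 i)) (by
            simpa [Prod.mk_zero_zero] using hq1.prodMk_nhds hc) (by
            filter_upwards [hqi, hq0] with a h1 h2
            exact div_ne_zero h2 h1) (by
            refine ht.congr' ?_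
            filter_upwards [hqi, hq0] with a h1 h2
            field_simp)
        have hπ1 : AnalyticAt ℝ (fun p => (π p).1) 0 := lj_comp (g := fun p : (Fin n → ℝ) × ℝ => p.1) analyticAt_fst hπ hπ0
        have hπ2 : AnalyticAt ℝ (fun p => (π p).2) 0 := lj_comp (g := fun p : (Fin n → ℝ) × ℝ => p.2) analyticAt_snd hπ hπ0
        have hπi : AnalyticAt ℝ (fun p => (π p).1 i) 0 := lj_comp (lj_an_fst i) hπ hπ0
        refine ⟨fun p => ((π p).1, (π p).1 i * (π p).2), y, G, hπ1.prod (hπi.mul hπ2),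
          by simp [hπ0, Prod.mk_zero_zero], hy, ?_, (hM2 i).mul hM1, hM2, hG, hG0, ?_⟩
        · filter_upwards [hqy, hc'] with a h1 h2
          rw [← h1, ← h2]
        · filter_upwards [hGe] with p hp
          rw [hp]; ring
      · have hmo : lj_mono γ' 0 = 0 := by
          have h1 := ht.mul hc
          rw [zero_mul] at h1
          refine tendsto_nhds_unique (((lj_mono_continuous γ').tendsto 0).comp hq1) (h1.congr' ?_)
          filter_upwards [hqi, hq0] with a h1 h2
          simp only [Function.comp]
          field_simp
        have hs : AnalyticAt ℝ (fun p : (Fin n → ℝ) × ℝ => p.2 + c) 0 := analyticAt_snd.add analyticAt_const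
        refine ⟨fun p => (p.1, p.1 i * (p.2 + c)), fun a => ((q a).1, (q a).2 / (q a).1 i - c),
          fun p => lj_mono γ' p.1 * (p.2 + c)⁻¹, analyticAt_fst.prod ((lj_an_fst i).mul hs),
          by simp [Prod.mk_zero_zero], ?_, ?_, ?_, fun j => lj_eta_fst j,
          (lj_an_mono γ').mul (hs.inv (by simpa using hc0)), by simp [hmo], ?_⟩
        · simpa [Prod.mk_zero_zero] using hq1.prodMk_nhds (hc.sub_const c)
        · filter_upwards [hc'] with a ha
          simp only [sub_add_cancel]
          rw [← ha]
        · exact (lj_eta_fst i).mul (lj_Mon.unit _ hs (by simpa using hc0))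
        · filter_upwards [hs.continuousAt.eventually_ne (by simpa using hc0 : (0 : (Fin n → ℝ) × ℝ).2 + c ≠ 0)] with p hp
          field_simp
    · have hu : AnalyticAt ℝ (fun p : (Fin n → ℝ) × ℝ =>
          p.1 + ((p.2 - 1) * p.1 i) • (Pi.single i 1 : Fin n → ℝ)) 0 :=
        analyticAt_fst.add (((analyticAt_snd.sub analyticAt_const).mul (lj_an_fst i)).smul analyticAt_const)
      have hui : ∀ p : (Fin n → ℝ) × ℝ, (p.1 + ((p.2 - 1) * p.1 i) • (Pi.single i 1 : Fin n → ℝ)) i = p.2 * p.1 i := by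
        intro p; simp; ring
      have huj : ∀ (p : (Fin n → ℝ) × ℝ) (j : Fin n), j ≠ i →
          (p.1 + ((p.2 - 1) * p.1 i) • (Pi.single i 1 : Fin n → ℝ)) j = p.1 j := by
        intro p j hj; simp [hj]
      refine ⟨fun p => (p.1 + ((p.2 - 1) * p.1 i) • (Pi.single i 1 : Fin n → ℝ), p.2),
        fun a => (Function.update (q a).1 i ((q a).1 i / (q a).2), (q a).2),
        fun p => p.1 i * lj_mono γ' (p.1 + ((p.2 - 1) * p.1 i) • (Pi.single i 1 : Fin n → ℝ)),
        hu.prod analyticAt_snd, by simp [Prod.mk_zero_zero], ?_, ?_, lj_eta_snd, ?_,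
        (lj_an_fst i).mul (lj_comp (lj_mono_analytic γ' 0) hu (by simp)), by simp, ?_⟩
      · have : Tendsto (fun a => Function.update (q a).1 i ((q a).1 i / (q a).2)) l (𝓝 0) := by
          rw [tendsto_pi_nhds]
          intro j
          by_cases hj : j = i
          · subst hj; simpa using hc
          · simpa [hj] using (tendsto_pi_nhds.1 hq1 j)
        simpa [Prod.mk_zero_zero] using this.prodMk_nhds hq2
      · filter_upwards [hc'] with a ha
        refine Prod.ext ?_ rfl
        ext j
        by_cases hj : j = i
        · subst hj
          refine Eq.trans ?_ (hui (Function.update (q a).1 j ((q a).1 j / (q a).2), (q a).2)).symm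
          simp only [Function.update_self]; field_simp
        · refine Eq.trans ?_ (huj (Function.update (q a).1 i ((q a).1 i / (q a).2), (q a).2) j hj).symm
          simp [hj]
      · intro j
        by_cases hj : j = i
        · subst hj
          simp only [hui]
          exact lj_eta_snd.mul (lj_eta_fst j)
        · simp only [huj _ _ hj]
          exact lj_eta_fst j
      · refine Eventually.of_forall fun p => ?_
        simp only [hui]; ring
end LemmaM

end SecPart4

section SecPart5
open Filter Topology Set

theorem lj_ift {E : Type*} [NormedAddCommGroup E] [NormedSpace ℝ E] [CompleteSpace E] {G : E × ℝ → ℝ}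
    (hG : AnalyticAt ℝ G 0) (hG0 : G 0 = 0) (hd : lj_dt G 0 ≠ 0) :
    ∃ φ : E → ℝ, AnalyticAt ℝ φ 0 ∧ φ 0 = 0 ∧ ∀ᶠ z in 𝓝 0, G (z, φ z) = 0 := by
  have hc : ContDiffAt ℝ (⊤ : WithTop ℕ∞) G (0 : E × ℝ) := hG.contDiffAt
  have hi : (fderiv ℝ G (0 : E × ℝ) ∘L .inr ℝ E ℝ).IsInvertible := by
    refine ⟨ContinuousLinearEquiv.unitsEquivAut ℝ (Units.mk0 _ hd), ?_⟩
    ext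
    simp [lj_dt]
  have hne : (⊤ : WithTop ℕ∞) ≠ 0 := by simp
  refine ⟨hc.implicitFunction hne hi, ?_, ?_, ?_⟩
  · exact (hc.contDiffAt_implicitFunction hne hi).analyticAt
  · exact hc.implicitFunction_apply_self hne hi
  · have := hc.eventually_apply_implicitFunction hne hi
    rw [hG0] at this
    exact this

section PowSub
variable {n : ℕ} {A : Type*}

def lj_UN (l : Ultrafilter A) (n : ℕ) : Prop := ∀ F : (Fin n → ℝ) → ℝ, AnalyticAt ℝ F 0 →
  (¬ ∀ᶠ z in 𝓝 0, F z = 0) → ∀ x : A → Fin n → ℝ, Tendsto x l (𝓝 0) → lj_Unif (l : Filter A) (lj_xi n) F x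

theorem lj_powsub (l : Ultrafilter A) (y : A → Fin n → ℝ) (hy : Tendsto y l (𝓝 0)) (N : ℕ) (hN : N ≠ 0) :
    ∃ (ε : Fin n → ℝ) (z : A → Fin n → ℝ), (∀ i, ε i ≠ 0) ∧ Tendsto z l (𝓝 0) ∧
      ∀ᶠ a in (l : Filter A), y a = fun i => ε i * z a i ^ N := by
  have h1 : ∀ i, ∃ e : ℝ, e ≠ 0 ∧ ∀ᶠ a in (l : Filter A), y a i = e * |y a i| := by
    intro i
    rcases l.em (fun a => 0 ≤ y a i) with h | h
    · exact ⟨1, one_ne_zero, by filter_upwards [h] with a ha; rw [abs_of_nonneg ha, one_mul]⟩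
    · refine ⟨-1, by norm_num, ?_⟩
      filter_upwards [h] with a ha
      rw [abs_of_neg (not_le.1 ha)]; ring
  choose ε hε0 hε using h1
  refine ⟨ε, fun a i => |y a i| ^ ((N:ℝ)⁻¹), hε0, ?_, ?_⟩
  · rw [tendsto_pi_nhds] at hy ⊢
    intro i
    have hN' : (N:ℝ)⁻¹ ≠ 0 := by simpa using hN
    have := (hy i).abs.rpow_const (p := (N:ℝ)⁻¹) (Or.inr (by positivity))
    simpa [Real.zero_rpow hN'] using this
  · filter_upwards [eventually_all.2 hε] with a ha
    ext i
    rw [Real.rpow_inv_natCast_pow (abs_nonneg _) hN]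
    exact ha i

theorem lj_UN_pow {l : Ultrafilter A} (hU : lj_UN l n) {N : ℕ} (hN : N ≠ 0) {m S : (Fin n → ℝ) → ℝ}
    (hm : AnalyticAt ℝ m 0) (hS : AnalyticAt ℝ S 0) (hm0 : ¬ ∀ᶠ z in 𝓝 0, m z = 0)
    (hS0 : ¬ ∀ᶠ z in 𝓝 0, S z = 0) (x : A → Fin n → ℝ) (hx : Tendsto x l (𝓝 0)) :
    ∃ (π : (Fin n → ℝ) → (Fin n → ℝ)) (y : A → Fin n → ℝ), AnalyticAt ℝ π 0 ∧ π 0 = 0 ∧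
      Tendsto y l (𝓝 0) ∧ (∀ᶠ a in (l : Filter A), x a = π (y a)) ∧
      lj_Mon (lj_xi n) (fun z => m (π z)) ∧ ∃ (γ : Fin n → ℕ) (w : (Fin n → ℝ) → ℝ),
        AnalyticAt ℝ w 0 ∧ w 0 ≠ 0 ∧ ∀ᶠ z in 𝓝 0, S (π z) = lj_mono γ z ^ N * w z := by
  obtain ⟨π, y, hπ, hπ0, hy, hxy, hM⟩ := hU (fun z => m z * S z) (hm.mul hS)
    (fun h => (lj_mul_eq_zero hm hS h).elim hm0 hS0) x hx
  have hMm := lj_Mon_of_mul (lj_comp hm hπ hπ0) (lj_comp hS hπ hπ0) hM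
  have hMS := lj_Mon_of_mul (lj_comp hS hπ hπ0) (lj_comp hm hπ hπ0)
    (hM.congr (Eventually.of_forall fun z => mul_comm _ _))
  obtain ⟨ε, z, hε, hz, hyz⟩ := lj_powsub l y hy N hN
  have hσ : AnalyticAt ℝ (fun (z : Fin n → ℝ) i => ε i * z i ^ N) 0 := by
    rw [analyticAt_pi_iff]
    intro i
    exact analyticAt_const.mul ((lj_coord_analytic i 0).pow N)
  have hσ0 : (fun i => ε i * (0 : Fin n → ℝ) i ^ N) = 0 := by
    ext i; simp [hN]
  refine ⟨fun z => π (fun i => ε i * z i ^ N), z, lj_comp hπ hσ hσ0, by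
    beta_reduce; rw [hσ0, hπ0], hz, ?_, ?_, ?_⟩
  · filter_upwards [hxy, hyz] with a h1 h2
    rw [h1, h2]
  · refine lj_Mon.comp (F := fun z => m (π z)) hMm hσ hσ0 fun i => ?_
    exact (lj_Mon.unit _ analyticAt_const (hε i)).mul ((lj_Mon.coord (lj_xi n) i).pow N)
  · obtain ⟨γ, w, hw, hw0, hSw⟩ := hMS
    refine ⟨γ, fun z => (∏ i, ε i ^ γ i) * w (fun i => ε i * z i ^ N),
      analyticAt_const.mul (lj_comp hw hσ hσ0), ?_, ?_⟩
    · beta_reduce; rw [hσ0]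
      exact mul_ne_zero (Finset.prod_ne_zero_iff.2 fun i _ => pow_ne_zero _ (hε i)) hw0
    · filter_upwards [(lj_tendsto hσ hσ0).eventually hSw] with z hz
      rw [hz, ← mul_assoc]
      congr 1
      unfold lj_xi lj_mono
      rw [← Finset.prod_pow, ← Finset.prod_mul_distrib]
      refine Finset.prod_congr rfl fun i _ => ?_
      rw [mul_pow, ← pow_mul, ← pow_mul, mul_comm N]; ring

theorem lj_mono_smul (k : ℕ) (γ : Fin n → ℕ) (z : Fin n → ℝ) : lj_mono (fun i => γ i * k) z = lj_mono γ z ^ k := by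
  unfold lj_mono
  rw [← Finset.prod_pow]
  exact Finset.prod_congr rfl fun i _ => pow_mul _ _ _

theorem lj_coeffs {l : Ultrafilter A} (hU : lj_UN l n) {d : ℕ} {m : (Fin n → ℝ) → ℝ}
    (hm : AnalyticAt ℝ m 0) (hm0 : ¬ ∀ᶠ z in 𝓝 0, m z = 0) {a : ℕ → (Fin n → ℝ) → ℝ}
    (ha : ∀ j, AnalyticAt ℝ (a j) 0) (ha0 : ∃ j < d, ¬ ∀ᶠ z in 𝓝 0, a j z = 0)
    (x : A → Fin n → ℝ) (hx : Tendsto x l (𝓝 0)) :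
    ∃ (π : (Fin n → ℝ) → (Fin n → ℝ)) (y : A → Fin n → ℝ), AnalyticAt ℝ π 0 ∧ π 0 = 0 ∧
      Tendsto y l (𝓝 0) ∧ (∀ᶠ a in (l : Filter A), x a = π (y a)) ∧
      lj_Mon (lj_xi n) (fun z => m (π z)) ∧ ∃ (γ : Fin n → ℕ) (b : ℕ → (Fin n → ℝ) → ℝ),
        (∀ j, AnalyticAt ℝ (b j) 0) ∧
        (∀ j < d, ∀ᶠ z in 𝓝 0, a j (π z) = lj_mono γ z ^ (d - j) * b j z) ∧ ∃ j < d, b j 0 ≠ 0 := by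
  let e : ℕ → ℕ := fun j => d.factorial / (d - j)
  have he : ∀ j < d, (d - j) * e j = d.factorial := fun j hj =>
    Nat.mul_div_cancel' (Nat.dvd_factorial (by omega) (by omega))
  have he0 : ∀ j < d, e j ≠ 0 := by
    intro j hj h
    have := he j hj
    rw [h, mul_zero] at this
    exact (Nat.factorial_pos d).ne this
  let S : (Fin n → ℝ) → ℝ := fun z => ∑ j ∈ Finset.range d, a j z ^ (2 * e j)
  have hS : AnalyticAt ℝ S 0 := by
    have := Finset.analyticAt_fun_sum (𝕜 := ℝ) (f := fun (j : ℕ) (z : Fin n → ℝ) => a j z ^ (2 * e j))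
      (c := 0) (Finset.range d) (fun j _ => (ha j).pow _)
    exact this
  have hpos : ∀ (t : ℝ) (k : ℕ), 0 ≤ t ^ (2 * k) := fun t k => by rw [pow_mul]; positivity
  have hS0 : ¬ ∀ᶠ z in 𝓝 0, S z = 0 := by
    intro h
    obtain ⟨j, hj, hj0⟩ := ha0
    apply hj0
    filter_upwards [h] with z hz
    have := (Finset.sum_eq_zero_iff_of_nonneg (fun j _ => hpos (a j z) (e j))).1 hz j (Finset.mem_range.2 hj)
    exact eq_zero_of_pow_eq_zero this
  have hN : 2 * d.factorial ≠ 0 := by have := Nat.factorial_pos d; omega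
  obtain ⟨π, y, hπ, hπ0, hy, hxy, hM, γ, w, hw, hw0, hSw⟩ := lj_UN_pow hU hN hm hS hm0 hS0 x hx
  refine ⟨π, y, hπ, hπ0, hy, hxy, hM, γ, ?_⟩
  have hb : ∀ j, ∃ b : (Fin n → ℝ) → ℝ, AnalyticAt ℝ b 0 ∧
      (j < d → ∀ᶠ z in 𝓝 0, a j (π z) = lj_mono γ z ^ (d - j) * b z) := by
    intro j
    by_cases hj : j < d
    · have hwb : ∀ᶠ z in 𝓝 0, |w z| ≤ |w 0| + 1 := by
        filter_upwards [hw.continuousAt.abs.eventually_lt (continuousAt_const (y := |w 0| + 1)) (by linarith)] with z hz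
        exact hz.le
      obtain ⟨b, hb, hbe⟩ := lj_div_mono _ (fun i => γ i * (d - j)) rfl (lj_comp (ha j) hπ hπ0) (|w 0| + 1) (by
        filter_upwards [hSw, hwb] with z h1 h2
        rw [lj_mono_smul]
        have hle : a j (π z) ^ (2 * e j) ≤ S (π z) :=
          Finset.single_le_sum (f := fun j => a j (π z) ^ (2 * e j)) (fun j _ => hpos _ _) (Finset.mem_range.2 hj)
        have hk : 2 * e j ≠ 0 := by have := he0 j hj; omega
        rw [← pow_le_pow_iff_left₀ (abs_nonneg _) (by positivity) hk]
        have hC : |w 0| + 1 ≤ (|w 0| + 1) ^ (2 * e j) := le_self_pow₀ (by linarith [abs_nonneg (w 0)]) hk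
        calc |a j (π z)| ^ (2 * e j) = a j (π z) ^ (2 * e j) := by
              rw [← abs_pow, abs_of_nonneg (hpos _ _)]
          _ ≤ lj_mono γ z ^ (2 * d.factorial) * w z := h1 ▸ hle
          _ ≤ lj_mono γ z ^ (2 * d.factorial) * (|w 0| + 1) ^ (2 * e j) := by
              gcongr
              · exact hpos _ _
              · exact ((le_abs_self _).trans h2).trans hC
          _ = _ := by
              rw [mul_pow, ← abs_pow, ← pow_mul, mul_comm]
              congr 1
              rw [show (d - j) * (2 * e j) = 2 * d.factorial by rw [← he j hj]; ring]
              exact (abs_of_nonneg (hpos _ _)).symm)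
      refine ⟨b, hb, fun _ => ?_⟩
      simpa only [lj_mono_smul] using hbe
    · exact ⟨0, analyticAt_const, fun h => absurd h hj⟩
  choose b hb hbe using hb
  refine ⟨b, hb, hbe, ?_⟩
  by_contra hcon
  push Not at hcon
  have hT : AnalyticAt ℝ (fun z => ∑ j ∈ Finset.range d, b j z ^ (2 * e j)) 0 := by
    have := Finset.analyticAt_fun_sum (𝕜 := ℝ) (f := fun (j : ℕ) (z : Fin n → ℝ) => b j z ^ (2 * e j))
      (c := 0) (Finset.range d) (fun j _ => (hb j).pow _)
    exact this
  have key := lj_mul_cancel (lj_mono_analytic (fun i => γ i * (2 * d.factorial)) 0) hT hw (lj_mono_ne _) (by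
    have hall : ∀ᶠ z in 𝓝 (0 : Fin n → ℝ), ∀ j ∈ Finset.range d, a j (π z) = lj_mono γ z ^ (d - j) * b j z :=
      (Finset.eventually_all _).2 fun j hj => hbe j (Finset.mem_range.1 hj)
    filter_upwards [hSw, hall] with z h1 h2
    rw [lj_mono_smul, ← h1, Finset.mul_sum]
    refine Finset.sum_congr rfl fun j hj => ?_
    rw [h2 j hj, mul_pow, ← pow_mul]
    congr 2
    rw [← he j (Finset.mem_range.1 hj)]; ring)
  have k0 := key.self_of_nhds
  apply hw0
  rw [← k0]
  refine Finset.sum_eq_zero fun j hj => ?_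
  have := he0 j (Finset.mem_range.1 hj)
  rw [hcon j (Finset.mem_range.1 hj), zero_pow (by omega)]
end PowSub

end SecPart5

section SecPart6
open Filter Topology Set

section CD
variable {n : ℕ} {A : Type*}

theorem lj_an_f {m : (Fin n → ℝ) → ℝ} (hm : AnalyticAt ℝ m 0) :
    AnalyticAt ℝ (fun p : (Fin n → ℝ) × ℝ => m p.1) 0 :=
  lj_comp (f := fun p : (Fin n → ℝ) × ℝ => p.1) hm analyticAt_fst rfl

theorem lj_Mon_fst {m : (Fin n → ℝ) → ℝ} (hm : lj_Mon (lj_xi n) m) :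
    lj_Mon (lj_eta n) (fun p => m p.1) :=
  lj_Mon.comp (π := fun p : (Fin n → ℝ) × ℝ => p.1) hm analyticAt_fst rfl (fun i => lj_eta_fst i)

theorem lj_lift {l : Ultrafilter A} (hU : lj_UN l n) {m : (Fin n → ℝ) → ℝ}
    (hm : AnalyticAt ℝ m 0) (hm0 : ¬ ∀ᶠ z in 𝓝 0, m z = 0) (k : ℕ) {u : (Fin n → ℝ) × ℝ → ℝ}
    (hu : AnalyticAt ℝ u 0) (hu0 : u 0 ≠ 0) (q : A → (Fin n → ℝ) × ℝ) (hq : Tendsto q l (𝓝 0)) :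
    lj_Unif (l : Filter A) (lj_eta n) (fun p => m p.1 * (p.2 ^ k * u p)) q := by
  have hq1 : Tendsto (fun a => (q a).1) l (𝓝 0) := (continuous_fst.tendsto 0).comp hq
  have hq2 : Tendsto (fun a => (q a).2) l (𝓝 0) := (continuous_snd.tendsto 0).comp hq
  obtain ⟨π, y, hπ, hπ0, hy, hxy, hM⟩ := hU m hm hm0 _ hq1
  have hP : AnalyticAt ℝ (fun p : (Fin n → ℝ) × ℝ => (π p.1, p.2)) 0 :=
    (lj_comp (f := fun p : (Fin n → ℝ) × ℝ => p.1) hπ analyticAt_fst rfl).prod analyticAt_snd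
  have hP0 : (π (0 : (Fin n → ℝ) × ℝ).1, (0 : (Fin n → ℝ) × ℝ).2) = 0 := by simp [hπ0, Prod.mk_zero_zero]
  refine ⟨fun p => (π p.1, p.2), fun a => (y a, (q a).2), hP, hP0, ?_, ?_, ?_⟩
  · simpa [Prod.mk_zero_zero] using hy.prodMk_nhds hq2
  · filter_upwards [hxy] with a ha
    exact Prod.ext ha rfl
  · refine (lj_Mon_fst hM).mul ((lj_eta_snd.pow k).mul (lj_Mon.unit _ (lj_comp hu hP hP0) ?_))
    beta_reduce
    rw [hP0]; exact hu0

def lj_C (l : Ultrafilter A) (n d : ℕ) : Prop :=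
  ∀ (F : (Fin n → ℝ) × ℝ → ℝ) (m : (Fin n → ℝ) → ℝ) (q : A → (Fin n → ℝ) × ℝ),
    AnalyticAt ℝ F 0 → lj_dt^[d] F 0 ≠ 0 → AnalyticAt ℝ m 0 → (¬ ∀ᶠ z in 𝓝 0, m z = 0) →
    Tendsto q l (𝓝 0) → lj_Unif (l : Filter A) (lj_eta n) (fun p => m p.1 * F p) q

theorem lj_poly_arg (d : ℕ) (hd : 0 < d) (b : ℕ → ℝ) (u c : ℝ) (g : ℝ → ℝ) (hg : ContinuousAt g 0)
    (hu : u ≠ 0) (hb : b (d - 1) = 0)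
    (h : ∀ᶠ s in 𝓝 (0:ℝ), ∑ j ∈ Finset.range d, b j * (s + c) ^ j + (s + c) ^ d * u = s ^ d * g s) :
    ∀ j < d, b j = 0 := by
  classical
  let P : Polynomial ℝ := ∑ j ∈ Finset.range d, Polynomial.C (b j) * (Polynomial.X + Polynomial.C c) ^ j
    + Polynomial.C u * (Polynomial.X + Polynomial.C c) ^ d
  have hP := lj_poly_coeff d P g hg (by
    refine (h.filter_mono nhdsWithin_le_nhds).mono fun s hs => ?_
    rw [← hs]
    simp [P, Polynomial.eval_finsetSum, mul_comm])
  have hco : ∀ k, P.coeff k = ∑ j ∈ Finset.range d, b j * (c ^ (j - k) * (j.choose k : ℝ))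
      + u * (c ^ (d - k) * (d.choose k : ℝ)) := by
    intro k
    simp [P, Polynomial.coeff_X_add_C_pow]
  have hc : c = 0 := by
    have h1 := hP (d - 1) (by omega)
    rw [hco, Finset.sum_eq_zero] at h1
    · have h2 : d.choose (d - 1) = d := by
        rw [Nat.choose_symm (by omega : 1 ≤ d), Nat.choose_one_right]
      rw [h2, show d - (d - 1) = 1 by omega] at h1
      have : (d:ℝ) ≠ 0 := by positivity
      simpa [hu, this] using h1
    · intro j hj
      rw [Finset.mem_range] at hj
      by_cases hj' : j = d - 1
      · rw [hj', hb, zero_mul]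
      · rw [Nat.choose_eq_zero_of_lt (by omega)]; simp
  intro j hj
  have h1 := hP j hj
  rw [hco, Finset.sum_eq_single j] at h1
  · rw [hc, zero_pow (by omega : d - j ≠ 0)] at h1
    simpa using h1
  · intro i _ hij
    rcases lt_or_gt_of_ne hij with hij | hij
    · rw [Nat.choose_eq_zero_of_lt hij]; simp
    · rw [hc, zero_pow (by omega)]; simp
  · intro h; exact absurd (Finset.mem_range.2 hj) h

theorem lj_an_sum {E : Type*} [NormedAddCommGroup E] [NormedSpace ℝ E] {f : ℕ → E → ℝ} {x : E} (d : ℕ)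
    (h : ∀ j, AnalyticAt ℝ (f j) x) : AnalyticAt ℝ (fun z => ∑ j ∈ Finset.range d, f j z) x :=
  Finset.analyticAt_fun_sum (Finset.range d) (fun j _ => h j)

theorem lj_case {l : Ultrafilter A} {d : ℕ} (hd : 0 < d) (ih : ∀ k < d, lj_C l n k)
    {m : (Fin n → ℝ) → ℝ} (hm : AnalyticAt ℝ m 0) (hmM : lj_Mon (lj_xi n) m) {γ : Fin n → ℕ}
    (hγ : lj_mono γ 0 = 0) {b : ℕ → (Fin n → ℝ) → ℝ} (hb : ∀ j, AnalyticAt ℝ (b j) 0)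
    (hbd : b (d - 1) 0 = 0) (hb0 : ∃ j < d, b j 0 ≠ 0) {u : (Fin n → ℝ) × ℝ → ℝ}
    (hu : AnalyticAt ℝ u 0) (hu0 : u 0 ≠ 0) (q : A → (Fin n → ℝ) × ℝ) (hq : Tendsto q l (𝓝 0)) :
    lj_Unif (l : Filter A) (lj_eta n) (fun p => m p.1 *
      (∑ j ∈ Finset.range d, lj_mono γ p.1 ^ (d - j) * b j p.1 * p.2 ^ j + p.2 ^ d * u p)) q := by
  have hq1 : Tendsto (fun a => (q a).1) l (𝓝 0) := (continuous_fst.tendsto 0).comp hq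
  rcases lj_dichotomy l (fun a => (q a).2) (fun a => lj_mono γ (q a).1) with ⟨c, hc, hc'⟩ | ⟨hc, hc'⟩
  · have hs : AnalyticAt ℝ (fun p : (Fin n → ℝ) × ℝ => p.2 + c) 0 := analyticAt_snd.add analyticAt_const
    have hρ : AnalyticAt ℝ (fun p : (Fin n → ℝ) × ℝ => (p.1, lj_mono γ p.1 * (p.2 + c))) 0 :=
      analyticAt_fst.prod ((lj_an_mono γ).mul hs)
    have hρ0 : ((0 : (Fin n → ℝ) × ℝ).1, lj_mono γ (0 : (Fin n → ℝ) × ℝ).1 * ((0 : (Fin n → ℝ) × ℝ).2 + c)) = 0 := by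
      simp [hγ, Prod.mk_zero_zero]
    refine lj_Unif.comp (x' := fun a => ((q a).1, (q a).2 / lj_mono γ (q a).1 - c)) hρ hρ0 ?_ ?_
    · filter_upwards [hc'] with a ha
      simp only [sub_add_cancel]
      rw [← ha]
    let G : (Fin n → ℝ) × ℝ → ℝ := fun p => ∑ j ∈ Finset.range d, b j p.1 * (p.2 + c) ^ j
      + (p.2 + c) ^ d * u (p.1, lj_mono γ p.1 * (p.2 + c))
    have hG : AnalyticAt ℝ G 0 :=
      (lj_an_sum d fun j => (lj_an_f (hb j)).mul (hs.pow j)).add ((hs.pow d).mul (lj_comp hu hρ hρ0))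
    have hk : ∃ k < d, lj_dt^[k] G 0 ≠ 0 := by
      by_contra hcon
      push Not at hcon
      obtain ⟨H, hH, hGH⟩ := lj_taylor d hG
      obtain ⟨j, hj, hj0⟩ := hb0
      have hin : Tendsto (fun s : ℝ => ((0, s) : (Fin n → ℝ) × ℝ)) (𝓝 0) (𝓝 0) := by
        have : Continuous (fun s : ℝ => ((0, s) : (Fin n → ℝ) × ℝ)) := by fun_prop
        simpa [Prod.mk_zero_zero] using this.tendsto 0
      refine hj0 (lj_poly_arg d hd (fun j => b j 0) (u 0) c (fun s => H (0, s)) ?_ hu0 hbd ?_ j hj)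
      · have : ContinuousAt (fun s : ℝ => ((0, s) : (Fin n → ℝ) × ℝ)) 0 := by fun_prop
        exact ContinuousAt.comp (g := H) (f := fun s : ℝ => ((0, s) : (Fin n → ℝ) × ℝ))
          (by simpa [Prod.mk_zero_zero] using hH.continuousAt) this
      · filter_upwards [hin.eventually hGH] with s hs
        rw [Finset.sum_eq_zero] at hs
        · simpa [G, hγ, Prod.mk_zero_zero] using hs
        · intro j hj
          have := hcon j (Finset.mem_range.1 hj)
          simp only [Prod.mk_zero_zero, this]; simp
    obtain ⟨k, hkd, hk⟩ := hk
    have h1 := ih k hkd G (fun z => m z * lj_mono γ z ^ d) (fun a => ((q a).1, (q a).2 / lj_mono γ (q a).1 - c))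
      hG hk (hm.mul ((lj_mono_analytic γ 0).pow d)) ?_ ?_
    · refine h1.congr (Eventually.of_forall fun p => ?_)
      simp only [G]
      rw [mul_assoc]
      congr 1
      rw [mul_add (lj_mono γ p.1 ^ d), Finset.mul_sum]
      congr 1
      · refine Finset.sum_congr rfl fun j hj => ?_
        rw [mul_pow]
        have : lj_mono γ p.1 ^ d = lj_mono γ p.1 ^ (d - j) * lj_mono γ p.1 ^ j := by
          rw [← pow_add]; congr 1; have := Finset.mem_range.1 hj; omega
        rw [this]; ring
      · rw [mul_pow, mul_assoc]
    · refine lj_Mon_ne (hmM.mul (lj_Mon.pow ?_ d))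
      exact ⟨γ, fun _ => 1, analyticAt_const, one_ne_zero, Eventually.of_forall fun z => by
        simp [lj_mono, lj_xi]⟩
    · simpa [Prod.mk_zero_zero] using hq1.prodMk_nhds (hc.sub_const c)
  · obtain ⟨π, y, G, hπ, hπ0, hy, hqy, hM1, hM2, hG, hG0, hGe⟩ := lj_lemmaM l _ γ rfl q hq hc' hc
    have hπ1 : AnalyticAt ℝ (fun p => (π p).1) 0 := lj_comp (g := fun p : (Fin n → ℝ) × ℝ => p.1) analyticAt_fst hπ hπ0
    have hπ10 : (π 0).1 = 0 := by simp [hπ0]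
    refine ⟨π, y, hπ, hπ0, hy, hqy, ?_⟩
    have hm1 := lj_Mon.comp hmM hπ1 hπ10 hM2
    have hv : AnalyticAt ℝ (fun p => ∑ j ∈ Finset.range d, G p ^ (d - j) * b j (π p).1 + u (π p)) 0 :=
      (lj_an_sum d fun j => (hG.pow _).mul (lj_comp (hb j) hπ1 hπ10)).add (lj_comp hu hπ hπ0)
    refine (hm1.mul ((hM1.pow d).mul (lj_Mon.unit _ hv ?_))).congr ?_
    · rw [Finset.sum_eq_zero]
      · simpa [hπ0] using hu0
      · intro j hj
        have := Finset.mem_range.1 hj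
        rw [hG0, zero_pow (by omega), zero_mul]
    · filter_upwards [hGe] with p hp
      congr 1
      rw [hp, mul_add, Finset.mul_sum]
      congr 1
      refine Finset.sum_congr rfl fun j hj => ?_
      rw [mul_pow]
      have : (π p).2 ^ d = (π p).2 ^ (d - j) * (π p).2 ^ j := by
        rw [← pow_add]; congr 1; have := Finset.mem_range.1 hj; omega
      rw [this]; ring

theorem lj_C_all {l : Ultrafilter A} (hU : lj_UN l n) (d : ℕ) : lj_C l n d := by
  induction d using Nat.strong_induction_on with
  | _ d ih =>
  intro F m q hF hFd hm hm0 hq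
  rcases Nat.eq_zero_or_pos d with rfl | hd
  · simpa using lj_lift hU hm hm0 0 hF hFd q hq
  by_cases hlow : ∃ j < d, lj_dt^[j] F 0 ≠ 0
  · obtain ⟨j, hj, hj0⟩ := hlow
    exact ih j hj F m q hF hj0 hm hm0 hq
  push Not at hlow
  obtain ⟨φ, hφ, hφ0, hφe⟩ := lj_ift (lj_dt_iter_analytic hF (d - 1)) (hlow (d - 1) (by omega)) (by
    rw [← Function.iterate_succ_apply' lj_dt]
    rwa [show (d - 1).succ = d by omega])
  have hφ1 := lj_an_f hφ
  have hρ : AnalyticAt ℝ (fun p : (Fin n → ℝ) × ℝ => (p.1, p.2 + φ p.1)) 0 :=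
    analyticAt_fst.prod (analyticAt_snd.add hφ1)
  have hρ0 : ((0 : (Fin n → ℝ) × ℝ).1, (0 : (Fin n → ℝ) × ℝ).2 + φ (0 : (Fin n → ℝ) × ℝ).1) = 0 := by
    simp [hφ0, Prod.mk_zero_zero]
  have hq1 : Tendsto (fun a => (q a).1) l (𝓝 0) := (continuous_fst.tendsto 0).comp hq
  have hq2 : Tendsto (fun a => (q a).2) l (𝓝 0) := (continuous_snd.tendsto 0).comp hq
  let F' : (Fin n → ℝ) × ℝ → ℝ := fun p => F (p.1, p.2 + φ p.1)
  have hF' : AnalyticAt ℝ F' 0 := lj_comp hF hρ hρ0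
  let q' : A → (Fin n → ℝ) × ℝ := fun a => ((q a).1, (q a).2 - φ (q a).1)
  have hq'2 : Tendsto (fun a => (q a).2 - φ (q a).1) l (𝓝 0) := by
    have := hq2.sub ((lj_tendsto hφ hφ0).comp hq1)
    simpa using this
  have hq' : Tendsto q' l (𝓝 0) := by
    simpa [q', Prod.mk_zero_zero] using hq1.prodMk_nhds hq'2
  suffices h : lj_Unif (l : Filter A) (lj_eta n) (fun p => m p.1 * F' p) q' by
    refine lj_Unif.comp (x' := q') hρ hρ0 (Eventually.of_forall fun a => ?_) h
    simp [q']
  have hsh := lj_dt_shift hF hφ hφ0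
  have hF'k : ∀ k, lj_dt^[k] F' 0 = lj_dt^[k] F 0 := by
    intro k
    have := (hsh k).self_of_nhds
    simpa [hφ0, Prod.mk_zero_zero] using this
  let a : ℕ → (Fin n → ℝ) → ℝ := fun j z => lj_dt^[j] F' (z, 0) / (j.factorial : ℝ)
  have hin : AnalyticAt ℝ (fun z : Fin n → ℝ => ((z, 0) : (Fin n → ℝ) × ℝ)) 0 := analyticAt_id.prod analyticAt_const
  have ha : ∀ j, AnalyticAt ℝ (a j) 0 := fun j =>
    (lj_comp (lj_dt_iter_analytic hF' j) hin (by simp [Prod.mk_zero_zero])).div_const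
  have ha0 : ∀ j < d, a j 0 = 0 := by
    intro j hj
    simp only [a, Prod.mk_zero_zero]
    rw [hF'k, hlow j hj, zero_div]
  have had : ∀ᶠ z in 𝓝 0, a (d - 1) z = 0 := by
    filter_upwards [lj_tendsto_inl.eventually (hsh (d - 1)), hφe] with z h1 h2
    simp only [a]
    have h3 : lj_dt^[d-1] F' (z, 0) = _ := h1
    rw [h3]
    simp only [zero_add]
    rw [h2, zero_div]
  obtain ⟨H, hH, hFH⟩ := lj_taylor (d + 1) hF'
  let u : (Fin n → ℝ) × ℝ → ℝ := fun p => a d p.1 + p.2 * H p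
  have hu : AnalyticAt ℝ u 0 := (lj_an_f (ha d)).add (analyticAt_snd.mul hH)
  have hu0 : u 0 ≠ 0 := by
    simp only [u, a, Prod.fst_zero, Prod.snd_zero, zero_mul, add_zero, Prod.mk_zero_zero]
    rw [hF'k]
    exact div_ne_zero hFd (by positivity)
  have hFu : ∀ᶠ p in 𝓝 (0 : (Fin n → ℝ) × ℝ), F' p = ∑ j ∈ Finset.range d, a j p.1 * p.2 ^ j + p.2 ^ d * u p := by
    filter_upwards [hFH] with p hp
    rw [hp, Finset.sum_range_succ]
    simp only [u, a]; ring
  by_cases hall : ∃ j < d, ¬ ∀ᶠ z in 𝓝 0, a j z = 0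
  · obtain ⟨π, y, hπ, hπ0, hy, hxy, hM, γ, b, hb, hab, hb0⟩ := lj_coeffs hU hm hm0 ha hall _ hq1
    have hP : AnalyticAt ℝ (fun p : (Fin n → ℝ) × ℝ => (π p.1, p.2)) 0 :=
      (lj_comp (f := fun p : (Fin n → ℝ) × ℝ => p.1) hπ analyticAt_fst rfl).prod analyticAt_snd
    have hP0 : (π (0 : (Fin n → ℝ) × ℝ).1, (0 : (Fin n → ℝ) × ℝ).2) = 0 := by simp [hπ0, Prod.mk_zero_zero]
    have hγ : lj_mono γ 0 = 0 := by
      obtain ⟨j, hj, hj0⟩ := hb0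
      have := (hab j hj).self_of_nhds
      rw [hπ0, ha0 j hj] at this
      exact eq_zero_of_pow_eq_zero ((mul_eq_zero.1 this.symm).resolve_right hj0)
    have hbd : b (d - 1) 0 = 0 := by
      refine (lj_mul_cancel (lj_mono_analytic γ 0) (hb (d-1)) analyticAt_const (lj_mono_ne γ)
        (H := fun _ => 0) ?_).self_of_nhds
      filter_upwards [hab (d-1) (by omega), (lj_tendsto hπ hπ0).eventually had] with z h1 h2
      rw [h2, show d - (d - 1) = 1 by omega, pow_one] at h1
      rw [← h1, mul_zero]
    refine lj_Unif.comp (ρ := fun p => (π p.1, p.2)) (x' := fun a => (y a, (q' a).2)) hP hP0 ?_ ?_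
    · filter_upwards [hxy] with a ha
      exact Prod.ext ha rfl
    refine (lj_case hd ih (lj_comp hm hπ hπ0) hM hγ hb hbd hb0 (lj_comp hu hP hP0)
      (by rwa [hP0]) (fun a => (y a, (q' a).2)) ?_).congr ?_
    · simpa [q', Prod.mk_zero_zero] using hy.prodMk_nhds hq'2
    · have hall2 : ∀ᶠ z in 𝓝 (0 : Fin n → ℝ), ∀ j ∈ Finset.range d, a j (π z) = lj_mono γ z ^ (d - j) * b j z :=
        (Finset.eventually_all _).2 fun j hj => hab j (Finset.mem_range.1 hj)
      filter_upwards [(lj_tendsto hP hP0).eventually hFu, lj_tendsto_fst0.eventually hall2] with p h1 h2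
      rw [h1]
      congr 2
      exact Finset.sum_congr rfl fun j hj => by rw [h2 j hj]
  · push Not at hall
    refine (lj_lift hU hm hm0 d hu hu0 q' hq').congr ?_
    have hall2 : ∀ᶠ z in 𝓝 (0 : Fin n → ℝ), ∀ j ∈ Finset.range d, a j z = 0 :=
      (Finset.eventually_all _).2 fun j hj => hall j (Finset.mem_range.1 hj)
    filter_upwards [hFu, lj_tendsto_fst0.eventually hall2] with p h1 h2
    rw [h1, Finset.sum_eq_zero (fun j hj => by rw [h2 j hj, zero_mul]), zero_add]
end CD

end SecPart6

section SecPart7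
open Filter Topology Set

section UNall
variable {A : Type*}

theorem lj_Unif_eta_xi {n : ℕ} {E : Type*} [NormedAddCommGroup E] [NormedSpace ℝ E] {l : Filter A}
    {F : E → ℝ} {x : A → E} (h : lj_Unif l (lj_eta n) F x) : lj_Unif l (lj_xi (n+1)) F x := by
  obtain ⟨π, y, hπ, hπ0, hy, hxy, hM⟩ := h
  have hσ : AnalyticAt ℝ (fun z : Fin (n+1) → ℝ => ((fun i : Fin n => z i.succ), z 0)) 0 := by
    refine AnalyticAt.prod ?_ (lj_coord_analytic 0 0)
    rw [analyticAt_pi_iff]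
    exact fun i => lj_coord_analytic i.succ 0
  have hσ0 : ((fun i : Fin n => (0 : Fin (n+1) → ℝ) i.succ), (0 : Fin (n+1) → ℝ) 0) = 0 := rfl
  refine ⟨fun z => π ((fun i : Fin n => z i.succ), z 0), fun a => Fin.cons (y a).2 (y a).1,
    lj_comp hπ hσ hσ0, ?_, ?_, ?_, ?_⟩
  · exact hπ0
  · rw [tendsto_pi_nhds]
    intro i
    refine Fin.cases ?_ (fun j => ?_) i
    · have h1 : Tendsto (fun a => (y a).2) l (𝓝 0) := (continuous_snd.tendsto 0).comp hy
      simpa using h1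
    · have h1 : Tendsto (fun a => (y a).1) l (𝓝 0) := (continuous_fst.tendsto 0).comp hy
      simpa using tendsto_pi_nhds.1 h1 j
  · filter_upwards [hxy] with a ha
    simpa using ha
  · refine lj_Mon.comp hM hσ hσ0 fun i => ?_
    cases i with
    | none => exact lj_Mon.coord (lj_xi (n+1)) 0
    | some i => exact lj_Mon.coord (lj_xi (n+1)) i.succ

theorem lj_UN_all (l : Ultrafilter A) (n : ℕ) : lj_UN l n := by
  induction n with
  | zero =>
    intro F hF hF0 x hx
    refine ⟨id, x, analyticAt_id, rfl, hx, Eventually.of_forall fun a => rfl, lj_Mon.unit _ hF ?_⟩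
    intro h
    exact hF0 (Eventually.of_forall fun z => by rw [Subsingleton.elim z 0]; exact h)
  | succ n ih =>
    intro F hF hF0 x hx
    by_cases h0 : F 0 = 0
    swap
    · exact ⟨id, x, analyticAt_id, rfl, hx, Eventually.of_forall fun a => rfl, lj_Mon.unit _ hF h0⟩
    obtain ⟨ε, hε, hball⟩ := Metric.eventually_nhds_iff_ball.1 hF.eventually_analyticAt
    have hv : ∃ v ∈ Metric.ball (0 : Fin (n+1) → ℝ) ε, F v ≠ 0 := by
      by_contra hcon
      push Not at hcon
      exact hF0 (Filter.mem_of_superset (Metric.ball_mem_nhds _ hε) hcon)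
    obtain ⟨v, hv, hFv⟩ := hv
    have hv0 : v ≠ 0 := by rintro rfl; exact hFv h0
    have hline : ¬ ∀ᶠ t in 𝓝 (0:ℝ), F (t • v) = 0 := by
      intro hcon
      have han : AnalyticOnNhd ℝ (fun t : ℝ => F (t • v)) (Icc 0 1) := by
        intro t ht
        refine AnalyticAt.comp (g := F) (f := fun t : ℝ => t • v) (hball _ ?_)
          (analyticAt_id.smul analyticAt_const)
        rw [mem_ball_zero_iff] at hv ⊢
        rw [norm_smul, Real.norm_eq_abs, abs_of_nonneg ht.1]
        exact lt_of_le_of_lt (mul_le_of_le_one_left (norm_nonneg _) ht.2) hv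
      have := han.eqOn_zero_of_preconnected_of_eventuallyEq_zero isPreconnected_Icc
        (left_mem_Icc.2 zero_le_one) hcon (right_mem_Icc.2 zero_le_one)
      exact hFv (by simpa using this)
    have hfr : Module.finrank ℝ ((Fin n → ℝ) × ℝ) = Module.finrank ℝ (Fin (n+1) → ℝ) := by simp
    let e0 := ContinuousLinearEquiv.ofFinrankEq hfr
    have hw : e0 (0, 1) ≠ 0 := by
      intro h
      have := e0.map_eq_zero_iff.1 h
      simpa using congrArg Prod.snd this
    obtain ⟨T, hT⟩ := SeparatingDual.exists_continuousLinearEquiv_apply_eq (R := ℝ) hw hv0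
    let L := e0.trans T
    have hL1 : L (0, 1) = v := hT
    have hL : ∀ t : ℝ, L (0, t) = t • v := by
      intro t
      rw [← hL1, ← map_smul]; simp
    have hFL : AnalyticAt ℝ (fun p => F (L p)) 0 := lj_comp hF (L.analyticAt 0) (map_zero L)
    obtain ⟨d, hd⟩ := lj_exists_reg hFL (by simpa only [hL] using hline)
    have hLx : Tendsto (fun a => L.symm (x a)) l (𝓝 0) := by
      have h1 := L.symm.continuous.tendsto 0
      rw [map_zero] at h1
      exact h1.comp hx
    have h1 := lj_C_all ih d (fun p => F (L p)) (fun _ => 1) (fun a => L.symm (x a)) hFL hd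
      analyticAt_const (fun h => one_ne_zero h.self_of_nhds) hLx
    refine lj_Unif_eta_xi (lj_Unif.comp (ρ := L) (L.analyticAt 0) (map_zero L)
      (x' := fun a => L.symm (x a)) (Eventually.of_forall fun a => by simp) ?_)
    simpa using h1
end UNall

theorem lj_mono_scale {n : ℕ} (α : Fin n → ℕ) (s : ℝ) (z : Fin n → ℝ) :
    lj_mono α (s • z) = s ^ (∑ i, α i) * lj_mono α z := by
  unfold lj_mono
  simp only [Pi.smul_apply, smul_eq_mul, mul_pow, Finset.prod_mul_distrib, Finset.prod_pow_eq_pow_sum]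

theorem lj_mono_euler {n : ℕ} (α : Fin n → ℕ) (z : Fin n → ℝ) :
    fderiv ℝ (lj_mono α) z z = (∑ i, α i : ℕ) * lj_mono α z := by
  have h1 : HasDerivAt (fun s : ℝ => s • z) z 1 := by
    simpa using (hasDerivAt_id (1:ℝ)).smul_const z
  have h2 : HasDerivAt (fun s : ℝ => lj_mono α (s • z)) (fderiv ℝ (lj_mono α) z z) 1 := by
    have h3 : HasFDerivAt (lj_mono α) (fderiv ℝ (lj_mono α) z) ((1:ℝ) • z) := by
      rw [one_smul]
      exact (lj_mono_analytic α z).differentiableAt.hasFDerivAt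
    exact HasFDerivAt.comp_hasDerivAt (l := lj_mono α) (f := fun s : ℝ => s • z) 1 h3 h1
  have h4 : HasDerivAt (fun s : ℝ => lj_mono α (s • z)) ((∑ i, α i : ℕ) * lj_mono α z) 1 := by
    simp only [lj_mono_scale]
    simpa using (hasDerivAt_pow (∑ i, α i) (1:ℝ)).mul_const (lj_mono α z)
  exact h2.unique h4

theorem lj_loj {E : Type*} [NormedAddCommGroup E] [NormedSpace ℝ E] [FiniteDimensional ℝ E]
    {f : E → ℝ} (hf : AnalyticAt ℝ f 0) (hf0 : f 0 = 0) {ε : ℝ} (hε : 0 < ε) :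
    ∀ᶠ x in 𝓝 0, |f x| ≤ ε * ‖fderiv ℝ f x‖ := by
  by_cases hz : ∀ᶠ x in 𝓝 0, f x = 0
  · filter_upwards [hz] with x hx
    rw [hx, abs_zero]; positivity
  by_contra hcon
  have hcon' : ∃ᶠ x in 𝓝 (0:E), ¬ |f x| ≤ ε * ‖fderiv ℝ f x‖ := not_eventually.1 hcon
  have hne : (𝓝 (0:E) ⊓ 𝓟 {x | ¬ |f x| ≤ ε * ‖fderiv ℝ f x‖}).NeBot :=
    frequently_mem_iff_neBot.1 hcon'
  let l : Ultrafilter E := Ultrafilter.of (𝓝 (0:E) ⊓ 𝓟 {x | ¬ |f x| ≤ ε * ‖fderiv ℝ f x‖})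
  have hl : (l : Filter E) ≤ _ := Ultrafilter.of_le _
  have hl0 : (l : Filter E) ≤ 𝓝 0 := hl.trans inf_le_left
  have hl1 : ∀ᶠ x in (l : Filter E), ¬ |f x| ≤ ε * ‖fderiv ℝ f x‖ :=
    le_principal_iff.1 (hl.trans inf_le_right)
  let L : E ≃L[ℝ] (Fin (Module.finrank ℝ E) → ℝ) := ContinuousLinearEquiv.ofFinrankEq (by simp)
  have hFL : AnalyticAt ℝ (fun z => f (L.symm z)) 0 := lj_comp hf (L.symm.analyticAt 0) (map_zero _)
  obtain ⟨π, y, hπ, hπ0, hy, hxy, hM⟩ := lj_UN_all l _ (fun z => f (L.symm z)) hFL (by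
      intro h
      apply hz
      have := (L.continuous.tendsto 0)
      rw [map_zero] at this
      filter_upwards [this.eventually h] with x hx
      simpa using hx) L (by
      have := (L.continuous.tendsto 0)
      rw [map_zero] at this
      exact this.mono_left hl0)
  let P : (Fin (Module.finrank ℝ E) → ℝ) → E := fun z => L.symm (π z)
  have hP : AnalyticAt ℝ P 0 := lj_comp (L.symm.analyticAt 0) hπ hπ0
  have hP0 : P 0 = 0 := by simp [P, hπ0]
  obtain ⟨α, u, hu, hu0, hfu⟩ := hM
  have hfu' : (fun z => f (P z)) =ᶠ[𝓝 0] fun z => lj_mono α z * u z := hfu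
  have hk : 1 ≤ ∑ i, α i := by
    by_contra h
    obtain rfl := lj_zero_of_sum α (by omega)
    have := hfu'.self_of_nhds
    beta_reduce at this
    rw [hP0, hf0] at this
    simp [lj_mono] at this
    exact hu0 this.symm
  have hdu : Tendsto (fun z => fderiv ℝ u z z) (𝓝 0) (𝓝 0) := by
    have : ContinuousAt (fun z => fderiv ℝ u z z) 0 := hu.fderiv.continuousAt.clm_apply continuousAt_id
    simpa using this.tendsto
  have hdP : Tendsto (fun z => ‖fderiv ℝ P z z‖) (𝓝 0) (𝓝 0) := by
    have : ContinuousAt (fun z => ‖fderiv ℝ P z z‖) 0 :=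
      (hP.fderiv.continuousAt.clm_apply continuousAt_id).norm
    simpa using this.tendsto
  have hulim : ∀ᶠ z in 𝓝 0, |u z| < 2 * |((∑ i, α i : ℕ) : ℝ) * u z + fderiv ℝ u z z| := by
    have h1 : Tendsto (fun z => |u z|) (𝓝 0) (𝓝 |u 0|) := hu.continuousAt.abs
    have h2 : Tendsto (fun z => 2 * |((∑ i, α i : ℕ) : ℝ) * u z + fderiv ℝ u z z|) (𝓝 0)
        (𝓝 (2 * |((∑ i, α i : ℕ) : ℝ) * u 0 + 0|)) :=
      (((hu.continuousAt.tendsto.const_mul _).add hdu).abs).const_mul 2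
    refine h1.eventually_lt h2 ?_
    rw [add_zero, abs_mul, Nat.abs_cast]
    have : (1:ℝ) ≤ ((∑ i, α i : ℕ) : ℝ) := by exact_mod_cast hk
    have := abs_pos.2 hu0
    nlinarith
  have main : ∀ᶠ z in 𝓝 0, |f (P z)| ≤ ε * ‖fderiv ℝ f (P z)‖ := by
    filter_upwards [hfu'.eventuallyEq_nhds, hulim, hdP.eventually_lt_const (half_pos hε), hu.eventually_analyticAt,
      hP.eventually_analyticAt, (lj_tendsto hP hP0).eventually hf.eventually_analyticAt] with z h1 h2 h3 h4 h5 h6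
    have e1 : fderiv ℝ (fun z => f (P z)) z z = fderiv ℝ f (P z) (fderiv ℝ P z z) := by
      have := (h6.differentiableAt.hasFDerivAt.comp z h5.differentiableAt.hasFDerivAt).fderiv
      have h7 : fderiv ℝ (fun z => f (P z)) z = _ := this
      rw [h7]; rfl
    have e2 : fderiv ℝ (fun z => f (P z)) z z = lj_mono α z * (((∑ i, α i : ℕ) : ℝ) * u z + fderiv ℝ u z z) := by
      rw [h1.fderiv_eq]
      have := ((lj_mono_analytic α z).differentiableAt.hasFDerivAt.mul h4.differentiableAt.hasFDerivAt).fderiv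
      have h7 : fderiv ℝ (fun z => lj_mono α z * u z) z = _ := this
      rw [h7]
      simp only [add_apply, smul_apply, smul_eq_mul, lj_mono_euler]
      ring
    have e3 : f (P z) = lj_mono α z * u z := h1.self_of_nhds
    have e4 : ‖fderiv ℝ f (P z) (fderiv ℝ P z z)‖ ≤ ‖fderiv ℝ f (P z)‖ * (ε / 2) :=
      ((fderiv ℝ f (P z)).le_opNorm _).trans (by gcongr)
    rw [← e1, e2, Real.norm_eq_abs, abs_mul] at e4
    rw [e3, abs_mul]
    have := mul_le_mul_of_nonneg_left h2.le (abs_nonneg (lj_mono α z))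
    linarith
  have hbad := (hy.eventually main).and (hxy.and hl1)
  obtain ⟨a, ha1, ha2, ha3⟩ := hbad.exists
  apply ha3
  have : P (y a) = a := by simp [P, ← ha2]
  rwa [this] at ha1

end SecPart7

section SecPart8
open Filter Topology Set

universe u

/-- the blown-up radial field -/
noncomputable def rg_w {E : Type u} [NormedAddCommGroup E] [InnerProductSpace ℝ E]
    (f : E → ℝ) (v : E → E) (x : E) : E := (f x * (‖v x‖ ^ 2)⁻¹) • v x

noncomputable def rg_B {E : Type u} [NormedAddCommGroup E] [InnerProductSpace ℝ E]
    (f : E → ℝ) (v : E → E) (X : E × E) : E →L[ℝ] E :=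
  (fderiv ℝ f X.1).smulRight X.2 + (‖X.2‖ ^ 2) • (fderiv ℝ v X.1)
    - (2:ℝ) • ((innerSL ℝ X.2).comp (fderiv ℝ v X.1)).smulRight X.2

theorem rg_W {E : Type u} [NormedAddCommGroup E] [InnerProductSpace ℝ E]
    {f : E → ℝ} {v : E → E} {x : E} (hf : DifferentiableAt ℝ f x) (hv : DifferentiableAt ℝ v x)
    (h0 : v x ≠ 0) : ∃ W : E →L[ℝ] E, HasFDerivAt (rg_w f v) W x ∧
      f x • W = rg_B f v (x, rg_w f v x) := by
  have hn : ‖v x‖ ^ 2 ≠ 0 := by simpa using h0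
  have h1 := (hasDerivAt_inv hn).comp_hasFDerivAt x hv.hasFDerivAt.norm_sq
  have h2 := (hf.hasFDerivAt.mul h1).smul hv.hasFDerivAt
  refine ⟨_, h2, ?_⟩
  ext y
  have hs : ‖rg_w f v x‖ ^ 2 = f x ^ 2 * (‖v x‖ ^ 2)⁻¹ := by
    rw [rg_w, norm_smul, mul_pow, Real.norm_eq_abs, sq_abs]
    field_simp
  simp only [rg_B, hs]
  simp [rg_w, smul_smul, inner_smul_left, -smul_eq_mul]
  simp only [smul_eq_mul, smul_add, smul_smul, add_smul]
  generalize inner ℝ (v x) (fderiv ℝ v x y) = a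
  have hn' : ‖v x‖ ≠ 0 := by simpa using h0
  match_scalars
  · field_simp
  · field_simp
    ring

noncomputable def rg_T {E : Type u} [NormedAddCommGroup E] [InnerProductSpace ℝ E]
    {H : Type u} [NormedAddCommGroup H] [NormedSpace ℝ H]
    (f : E → ℝ) (v : E → E) (p : ℕ) (Θ : E × E → H) (X : E × E) : E →L[ℝ] H :=
  ((p:ℝ) + 1) • (fderiv ℝ f X.1).smulRight (Θ X)
    + f X.1 • (fderiv ℝ Θ X).comp (ContinuousLinearMap.inl ℝ E E)
    + (fderiv ℝ Θ X).comp ((ContinuousLinearMap.inr ℝ E E).comp (rg_B f v X))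

theorem rg_T_smooth {E : Type u} [NormedAddCommGroup E] [InnerProductSpace ℝ E]
    {H : Type u} [NormedAddCommGroup H] [NormedSpace ℝ H]
    {f : E → ℝ} {v : E → E} (p : ℕ) {Θ : E × E → H} 
    (hf : ContDiffAt ℝ (⊤ : ℕ∞) f 0) (hv : ContDiffAt ℝ (⊤ : ℕ∞) v 0) 
    (hΘ : ContDiffAt ℝ (⊤ : ℕ∞) Θ 0) : ContDiffAt ℝ (⊤ : ℕ∞) (rg_T f v p Θ) 0 := by
  have hfst : ContDiffAt ℝ (⊤ : ℕ∞) (fun X : E × E => X.1) 0 := contDiffAt_fst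
  have hsnd : ContDiffAt ℝ (⊤ : ℕ∞) (fun X : E × E => X.2) 0 := contDiffAt_snd
  have hf1 : ContDiffAt ℝ (⊤ : ℕ∞) (fun X : E × E => f X.1) 0 :=
    ContDiffAt.comp (0 : E × E) (g := f) (by exact hf) hfst
  have hdf : ContDiffAt ℝ (⊤ : ℕ∞) (fun X : E × E => fderiv ℝ f X.1) 0 :=
    ContDiffAt.comp (0 : E × E) (g := fderiv ℝ f)
      (by exact hf.fderiv_right (m := (⊤ : ℕ∞)) (by simp)) hfst
  have hdv : ContDiffAt ℝ (⊤ : ℕ∞) (fun X : E × E => fderiv ℝ v X.1) 0 :=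
    ContDiffAt.comp (0 : E × E) (g := fderiv ℝ v)
      (by exact hv.fderiv_right (m := (⊤ : ℕ∞)) (by simp)) hfst
  have hdΘ : ContDiffAt ℝ (⊤ : ℕ∞) (fun X : E × E => fderiv ℝ Θ X) 0 :=
    hΘ.fderiv_right (m := (⊤ : ℕ∞)) (by simp)
  have hB : ContDiffAt ℝ (⊤ : ℕ∞) (rg_B f v) 0 := by
    unfold rg_B
    have hi : ContDiffAt ℝ (⊤ : ℕ∞) (fun X : E × E => innerSL ℝ X.2) 0 :=
      (innerSL ℝ (E := E)).contDiff.contDiffAt.comp _ hsnd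
    have b1 : ContDiffAt ℝ (⊤ : ℕ∞) (fun X : E × E => (fderiv ℝ f X.1).smulRight X.2) 0 :=
      hdf.smulRight hsnd
    have b2 : ContDiffAt ℝ (⊤ : ℕ∞) (fun X : E × E => (‖X.2‖ ^ 2) • (fderiv ℝ v X.1)) 0 :=
      (hsnd.norm_sq ℝ).smul hdv
    have b3 : ContDiffAt ℝ (⊤ : ℕ∞)
        (fun X : E × E => (innerSL ℝ X.2).comp (fderiv ℝ v X.1)) 0 := hi.clm_comp hdv
    have b4 : ContDiffAt ℝ (⊤ : ℕ∞)
        (fun X : E × E => ((innerSL ℝ X.2).comp (fderiv ℝ v X.1)).smulRight X.2) 0 :=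
      b3.smulRight hsnd
    exact (b1.add b2).sub (b4.const_smul (2:ℝ))
  have t1 : ContDiffAt ℝ (⊤ : ℕ∞) (fun X : E × E => (fderiv ℝ f X.1).smulRight (Θ X)) 0 :=
    hdf.smulRight hΘ
  have t2 : ContDiffAt ℝ (⊤ : ℕ∞) 
      (fun X : E × E => (fderiv ℝ Θ X).comp (ContinuousLinearMap.inl ℝ E E)) 0 :=
    hdΘ.clm_comp contDiffAt_const
  have t3 : ContDiffAt ℝ (⊤ : ℕ∞) 
      (fun X : E × E => (ContinuousLinearMap.inr ℝ E E).comp (rg_B f v X)) 0 :=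
    contDiffAt_const.clm_comp hB
  have t4 : ContDiffAt ℝ (⊤ : ℕ∞) (fun X : E × E =>
      (fderiv ℝ Θ X).comp ((ContinuousLinearMap.inr ℝ E E).comp (rg_B f v X))) 0 :=
    hdΘ.clm_comp t3
  exact ((t1.const_smul ((p:ℝ)+1)).add (hf1.smul t2)).add t4

theorem rg_pair {E : Type u} [NormedAddCommGroup E] {w : E → E} (hw : Tendsto w (𝓝 0) (𝓝 0)) :
    Tendsto (fun x => (x, w x)) (𝓝 0) (𝓝 (0 : E × E)) := by
  have := (tendsto_id (α := E) (x := 𝓝 0)).prodMk_nhds hw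
  simpa only [id, Prod.mk_zero_zero] using this

theorem rg_bdd {E : Type u} [NormedAddCommGroup E]
    {H : Type u} [NormedAddCommGroup H] {w : E → E} {Θ : E × E → H}
    (hw : Tendsto w (𝓝 0) (𝓝 0)) (hΘ : ContinuousAt Θ 0) :
    ∃ C, ∀ᶠ x in 𝓝 0, ‖Θ (x, w x)‖ ≤ C := by
  have h := (hΘ.tendsto.comp (rg_pair hw)).norm
  exact ⟨_, (h.eventually_le_const (lt_add_one _))⟩

theorem rg_D {E : Type u} [NormedAddCommGroup E] [InnerProductSpace ℝ E]
    {H : Type u} [NormedAddCommGroup H] [NormedSpace ℝ H]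
    {f : E → ℝ} {v : E → E} (p : ℕ) (hp : 1 ≤ p) {Θ : E × E → H} 
    (hf : ContDiffAt ℝ (⊤ : ℕ∞) f 0) (hv : ContDiffAt ℝ (⊤ : ℕ∞) v 0) 
    (hΘ : ContDiffAt ℝ (⊤ : ℕ∞) Θ 0) (hw : Tendsto (rg_w f v) (𝓝 0) (𝓝 0))
    (hZ : ∀ᶠ x in 𝓝 0, v x = 0 → f x = 0 ∧ fderiv ℝ f x = 0) :
    ∀ᶠ x in 𝓝 0, HasFDerivAt (fun x => f x ^ (p + 1) • Θ (x, rg_w f v x))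
      (f x ^ p • rg_T f v p Θ (x, rg_w f v x)) x := by
  obtain ⟨C, hC⟩ := rg_bdd hw hΘ.continuousAt
  have one : (1 : WithTop ℕ∞) ≠ ((⊤ : ℕ∞) : WithTop ℕ∞) := by simp
  have hle : (1 : WithTop ℕ∞) ≤ ((⊤ : ℕ∞) : WithTop ℕ∞) := by
    exact_mod_cast le_top (a := (1 : ℕ∞))
  have e1 := (hf.of_le hle).eventually (by simp)
  have e2 := (hv.of_le hle).eventually (by simp)
  have e3 := (rg_pair hw).eventually ((hΘ.of_le hle).eventually (by simp))
  filter_upwards [e1, e2, e3, hZ, hC.eventually_nhds] with x h1 h2 h3 h4 h5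
  have hfx := h1.differentiableAt (by simp)
  have hvx := h2.differentiableAt (by simp)
  have hΘx := h3.differentiableAt (by simp)
  by_cases hvz : v x = 0
  · obtain ⟨hf0, hd0⟩ := h4 hvz
    rw [hf0, zero_pow (by omega), zero_smul]
    have ho : (fun y => f y) =o[𝓝 x] fun y => y - x := by
      have := hfx.hasFDerivAt.isLittleO
      simpa [hf0, hd0] using this
    have hO : (fun y => f y ^ p • Θ (y, rg_w f v y)) =O[𝓝 x] fun _ => (1:ℝ) := by
      have hc : (fun y => f y ^ p) =O[𝓝 x] fun _ => (1:ℝ) :=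
        (hfx.continuousAt.pow p).isBigO_one ℝ
      have hb : (fun y => Θ (y, rg_w f v y)) =O[𝓝 x] fun _ => (1:ℝ) :=
        Asymptotics.IsBigO.of_bound C (by simpa using h5)
      simpa using hc.smul hb
    refine HasFDerivAt.of_isLittleO ?_
    simp only [hf0, zero_pow (Nat.succ_ne_zero p), zero_smul, sub_zero, 
      zero_apply]
    have h6 : (fun y => f y ^ (p+1) • Θ (y, rg_w f v y)) =o[𝓝 x] fun y => (‖y - x‖ : ℝ) := by
      have h7 := ho.norm_right.smul_isBigO hO
      simpa [smul_smul, pow_succ'] using h7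
    exact h6.of_norm_right
  · obtain ⟨W, hW, hWB⟩ := rg_W hfx hvx hvz
    have hc := hΘx.hasFDerivAt.comp x ((hasFDerivAt_id x).prodMk hW)
    have := (hfx.hasFDerivAt.pow (p+1)).smul hc
    refine this.congr_fderiv ?_
    ext y
    have hy : f x • W y = rg_B f v (x, rg_w f v x) y := by
      rw [← hWB]; rfl
    simp only [rg_T, ← hWB, Function.comp]
    have hs : ∀ a b : E, fderiv ℝ Θ (x, rg_w f v x) (a, b) 
       = fderiv ℝ Θ (x, rg_w f v x) (a, 0) + fderiv ℝ Θ (x, rg_w f v x) (0, b) := by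
      intro a b; rw [← map_add]; simp
    simp [-smul_eq_mul]
    rw [hs]
    module

theorem rg_cont {E : Type u} [NormedAddCommGroup E] [InnerProductSpace ℝ E]
    {H : Type u} [NormedAddCommGroup H] [NormedSpace ℝ H]
    {f : E → ℝ} {v : E → E} (p : ℕ) (hp : 1 ≤ p) {Θ : E × E → H} 
    (hf : ContDiffAt ℝ (⊤ : ℕ∞) f 0) (hv : ContDiffAt ℝ (⊤ : ℕ∞) v 0) 
    (hΘ : ContDiffAt ℝ (⊤ : ℕ∞) Θ 0) (hw : Tendsto (rg_w f v) (𝓝 0) (𝓝 0))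
    (hZ : ∀ᶠ x in 𝓝 0, v x = 0 → f x = 0 ∧ fderiv ℝ f x = 0) :
    ∀ᶠ x in 𝓝 0, ContinuousAt (fun x => f x ^ p • Θ (x, rg_w f v x)) x := by
  obtain ⟨C, hC⟩ := rg_bdd hw hΘ.continuousAt
  have hle : (1 : WithTop ℕ∞) ≤ ((⊤ : ℕ∞) : WithTop ℕ∞) := by
    exact_mod_cast le_top (a := (1 : ℕ∞))
  have e1 := (hf.of_le hle).eventually (by simp)
  have e2 := (hv.of_le hle).eventually (by simp)
  have e3 := (rg_pair hw).eventually ((hΘ.of_le hle).eventually (by simp))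
  filter_upwards [e1, e2, e3, hZ, hC.eventually_nhds] with x h1 h2 h3 h4 h5
  have hfx := h1.differentiableAt (by simp)
  have hvx := h2.differentiableAt (by simp)
  have hΘx := h3.differentiableAt (by simp)
  by_cases hvz : v x = 0
  · obtain ⟨hf0, hd0⟩ := h4 hvz
    have hb : (fun y => Θ (y, rg_w f v y)) =O[𝓝 x] fun _ => (1:ℝ) :=
        Asymptotics.IsBigO.of_bound C (by simpa using h5)
    have hc : (fun y => f y ^ p) =o[𝓝 x] fun _ => (1:ℝ) := by
      rw [Asymptotics.isLittleO_one_iff]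
      have : Tendsto (fun y => f y ^ p) (𝓝 x) (𝓝 (f x ^ p)) := (hfx.continuousAt.pow p).tendsto
      simpa [hf0, show p ≠ 0 by omega] using this
    have h7 := hc.smul_isBigO hb
    have h8 : Tendsto (fun x => f x ^ p • Θ (x, rg_w f v x)) (𝓝 x) (𝓝 0) := by
      rw [← Asymptotics.isLittleO_one_iff ℝ]
      simpa using h7
    rw [ContinuousAt]
    simpa [hf0, show p ≠ 0 by omega] using h8
  · obtain ⟨W, hW, hWB⟩ := rg_W hfx hvx hvz
    have hc := (hΘx.hasFDerivAt.comp x ((hasFDerivAt_id x).prodMk hW)).continuousAt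
    exact (hfx.continuousAt.pow p).smul hc

theorem rg_main {E : Type u} [NormedAddCommGroup E] [InnerProductSpace ℝ E]
    {f : E → ℝ} {v : E → E} 
    (hf : ContDiffAt ℝ (⊤ : ℕ∞) f 0) (hv : ContDiffAt ℝ (⊤ : ℕ∞) v 0) 
    (hw : Tendsto (rg_w f v) (𝓝 0) (𝓝 0))
    (hZ : ∀ᶠ x in 𝓝 0, v x = 0 → f x = 0 ∧ fderiv ℝ f x = 0) (k : ℕ) :
    ∀ (H : Type u) [NormedAddCommGroup H] [NormedSpace ℝ H] (Θ : E × E → H) (p : ℕ),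
     ContDiffAt ℝ (⊤ : ℕ∞) Θ 0 → k + 1 ≤ p → 
     ContDiffAt ℝ k (fun x => f x ^ p • Θ (x, rg_w f v x)) 0 := by
  induction k with
  | zero =>
    intro H _ _ Θ p hΘ hp
    have := rg_cont p (by omega) hf hv hΘ hw hZ
    simp only [Nat.cast_zero]
    rw [contDiffAt_zero]
    exact ⟨_, this, fun x hx => ContinuousAt.continuousWithinAt hx⟩
  | succ k ih =>
    intro H _ _ Θ p hΘ hp
    obtain ⟨q, rfl⟩ : ∃ q, p = q + 1 := ⟨p - 1, by omega⟩
    have := rg_D q (by omega) hf hv hΘ hw hZ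
    push_cast
    rw [contDiffAt_succ_iff_hasFDerivAt]
    exact ⟨_, ⟨_, this, fun x hx => hx⟩, ih _ _ q (rg_T_smooth q hf hv hΘ) (by omega)⟩

end SecPart8

section SecPart9
open Filter Topology Set

theorem pm_taylor {E : Type*} [NormedAddCommGroup E] [NormedSpace ℝ E] [CompleteSpace E]
    {g : E → ℝ} (hg : AnalyticAt ℝ g 0)
    (c : ℝ) : ∃ G : ((E × E) × ℝ) × ℝ → ℝ, AnalyticAt ℝ G 0 ∧ ∀ᶠ p in 𝓝 (0 : ((E × E) × ℝ) × ℝ),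
      g (p.1.1.1 + (p.2 * (p.1.2 + c)) • p.1.1.2) = g p.1.1.1
        + p.2 * ((p.1.2 + c) * fderiv ℝ g p.1.1.1 p.1.1.2) + p.2 ^ 2 * G p := by
  have hK : AnalyticAt ℝ (fun p : ((E × E) × ℝ) × ℝ =>
      g (p.1.1.1 + (p.2 * (p.1.2 + c)) • p.1.1.2)) 0 := by
    have a1 : AnalyticAt ℝ (fun p : ((E × E) × ℝ) × ℝ => p.1.1.1) 0 :=
      (((ContinuousLinearMap.fst ℝ E E).comp (ContinuousLinearMap.fst ℝ (E × E) ℝ)).comp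
        (ContinuousLinearMap.fst ℝ ((E × E) × ℝ) ℝ)).analyticAt 0
    have a2 : AnalyticAt ℝ (fun p : ((E × E) × ℝ) × ℝ => p.1.1.2) 0 :=
      (((ContinuousLinearMap.snd ℝ E E).comp (ContinuousLinearMap.fst ℝ (E × E) ℝ)).comp
        (ContinuousLinearMap.fst ℝ ((E × E) × ℝ) ℝ)).analyticAt 0
    have a3 : AnalyticAt ℝ (fun p : ((E × E) × ℝ) × ℝ => p.1.2) 0 :=
      ((ContinuousLinearMap.snd ℝ (E × E) ℝ).comp
        (ContinuousLinearMap.fst ℝ ((E × E) × ℝ) ℝ)).analyticAt 0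
    have a4 : AnalyticAt ℝ (fun p : ((E × E) × ℝ) × ℝ => p.2) 0 :=
      (ContinuousLinearMap.snd ℝ ((E × E) × ℝ) ℝ).analyticAt 0
    exact lj_comp hg (a1.add ((a4.mul (a3.add analyticAt_const)).smul a2)) (by simp)
  obtain ⟨G, hG, hT⟩ := lj_taylor 2 hK
  refine ⟨G, hG, ?_⟩
  have ht : Tendsto (fun p : ((E × E) × ℝ) × ℝ => p.1.1.1) (𝓝 0) (𝓝 0) :=
    lj_tendsto ((((ContinuousLinearMap.fst ℝ E E).comp (ContinuousLinearMap.fst ℝ (E × E) ℝ)).comp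
        (ContinuousLinearMap.fst ℝ ((E × E) × ℝ) ℝ)).analyticAt 0) (by simp)
  filter_upwards [hT, ht.eventually hg.eventually_analyticAt] with p hp hgp
  rw [hp]
  have e : lj_dt (fun p : ((E × E) × ℝ) × ℝ =>
      g (p.1.1.1 + (p.2 * (p.1.2 + c)) • p.1.1.2)) (p.1, 0)
      = (p.1.2 + c) * fderiv ℝ g p.1.1.1 p.1.1.2 := by
    have hd : HasFDerivAt g (fderiv ℝ g p.1.1.1)
      ((fun p : ((E × E) × ℝ) × ℝ => p.1.1.1 + (p.2 * (p.1.2 + c)) • p.1.1.2) (p.1, 0)) := by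
      simpa using hgp.differentiableAt.hasFDerivAt
    have hKd : DifferentiableAt ℝ (fun p : ((E × E) × ℝ) × ℝ =>
      g (p.1.1.1 + (p.2 * (p.1.2 + c)) • p.1.1.2)) (p.1, 0) := by
      refine DifferentiableAt.comp _ (g := g) hd.differentiableAt ?_
      fun_prop
    have hl : HasDerivAt (fun s : ℝ => (p.1, s)) ((0, 1) : ((E × E) × ℝ) × ℝ) 0 :=
      (hasDerivAt_const _ _).prodMk (hasDerivAt_id _)
    have h1 := hKd.hasFDerivAt.comp_hasDerivAt (0:ℝ) hl
    have hl2 : HasDerivAt (fun s : ℝ => p.1.1.1 + (s * (p.1.2 + c)) • p.1.1.2)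
        ((1 * (p.1.2 + c)) • p.1.1.2) 0 :=
      (((hasDerivAt_id (0:ℝ)).mul_const _).smul_const _).const_add _
    have hd2 : HasFDerivAt g (fderiv ℝ g p.1.1.1)
      (p.1.1.1 + ((0:ℝ) * (p.1.2 + c)) • p.1.1.2) := by
      simpa using hgp.differentiableAt.hasFDerivAt
    have h2 := hd2.comp_hasDerivAt (0:ℝ) hl2
    have := h1.unique h2
    simpa [lj_dt] using this
  rw [Finset.sum_range_succ, Finset.sum_range_succ]
  simp [e]
  ring

theorem pm_Dg {E : Type*} [NormedAddCommGroup E] [NormedSpace ℝ E]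
    {f g h : E → ℝ} (hf : AnalyticAt ℝ f 0) (hh : AnalyticAt ℝ h 0) (m : ℕ)
    (hgf : ∀ᶠ x in 𝓝 0, g x - f x = h x * f x ^ (m + 1)) :
    ∀ᶠ x in 𝓝 0, ∀ y, fderiv ℝ f x y = f x → fderiv ℝ g x y =
      f x * (1 + (m + 1) * h x * f x ^ m + f x ^ m * fderiv ℝ h x y) := by
  have hfd := (hf.contDiffAt (n := 1)).eventually (by simp)
  have hhd := (hh.contDiffAt (n := 1)).eventually (by simp)
  filter_upwards [hfd, hhd, hgf.eventually_nhds] with x h1 h2 h3 y hy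
  have hge : g =ᶠ[𝓝 x] fun x => f x + h x * f x ^ (m + 1) := by
    filter_upwards [h3] with z hz
    linarith
  have hF := (h1.differentiableAt (by simp)).hasFDerivAt
  have hH := (h2.differentiableAt (by simp)).hasFDerivAt
  have hG : HasFDerivAt (fun x => f x + h x * f x ^ (m + 1)) _ x := hF.add (hH.mul (hF.pow (m + 1)))
  rw [hge.fderiv_eq, hG.fderiv]
  simp [hy]
  ring

theorem pm_sigma {E : Type*} [NormedAddCommGroup E] [NormedSpace ℝ E] [CompleteSpace E]
    {f g h : E → ℝ} (hf : AnalyticAt ℝ f 0) (hg : AnalyticAt ℝ g 0) (hh : AnalyticAt ℝ h 0)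
    (hf0 : f 0 = 0) (r : ℕ) (hr : 1 ≤ r)
    (hgf : ∀ᶠ x in 𝓝 0, g x - f x = h x * f x ^ (r + 2)) {w : E → E}
    (hw : Tendsto w (𝓝 0) (𝓝 0)) (hdw : ∀ᶠ x in 𝓝 0, fderiv ℝ f x (w x) = f x) :
    ∃ S : E × E → ℝ, AnalyticAt ℝ S 0 ∧
      ∀ᶠ x in 𝓝 0, g (x + f x ^ (r + 1) • (S (x, w x) • w x)) = f x := by
  obtain ⟨G, hG, hT⟩ := pm_taylor hg (-h 0)
  set Ψ : (E × E) × ℝ → ℝ := fun q => h q.1.1 + (q.2 + -h 0) *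
    (1 + (r + 2) * h q.1.1 * f q.1.1 ^ (r + 1) + f q.1.1 ^ (r + 1) * fderiv ℝ h q.1.1 q.1.2)
    + f q.1.1 ^ r * G (q, f q.1.1 ^ (r + 1)) with hΨ
  have hq : AnalyticAt ℝ (fun q : (E × E) × ℝ => q.1.1) 0 :=
    ((ContinuousLinearMap.fst ℝ E E).comp (ContinuousLinearMap.fst ℝ (E × E) ℝ)).analyticAt 0
  have hq2 : AnalyticAt ℝ (fun q : (E × E) × ℝ => q.1.2) 0 :=
    ((ContinuousLinearMap.snd ℝ E E).comp (ContinuousLinearMap.fst ℝ (E × E) ℝ)).analyticAt 0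
  have hq3 : AnalyticAt ℝ (fun q : (E × E) × ℝ => q.2) 0 :=
    (ContinuousLinearMap.snd ℝ (E × E) ℝ).analyticAt 0
  have ah : AnalyticAt ℝ (fun q : (E × E) × ℝ => h q.1.1) 0 := lj_comp hh hq (by simp)
  have af : AnalyticAt ℝ (fun q : (E × E) × ℝ => f q.1.1) 0 := lj_comp hf hq (by simp)
  have adh : AnalyticAt ℝ (fun q : (E × E) × ℝ => fderiv ℝ h q.1.1) 0 :=
    lj_comp hh.fderiv hq (by simp)
  have adh2 : AnalyticAt ℝ (fun q : (E × E) × ℝ => fderiv ℝ h q.1.1 q.1.2) 0 :=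
    AnalyticAt.comp₂ (h := fun (y : (E →L[ℝ] ℝ) × E) => y.1 y.2)
      ((ContinuousLinearMap.id ℝ (E →L[ℝ] ℝ)).analyticAt_bilinear _) adh hq2
  have aG : AnalyticAt ℝ (fun q : (E × E) × ℝ => G (q, f q.1.1 ^ (r + 1))) 0 :=
    lj_comp hG (analyticAt_id.prod (af.pow _)) (by simp [hf0])
  have aΨ : AnalyticAt ℝ Ψ 0 := by
    exact (ah.add ((hq3.add analyticAt_const).mul ((analyticAt_const.add
      ((analyticAt_const.mul ah).mul (af.pow _))).add ((af.pow _).mul adh2)))).add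
      ((af.pow _).mul aG)
  have Ψ0 : ∀ s : ℝ, Ψ (0, s) = s := by
    intro s
    simp [hΨ, hf0, show r ≠ 0 by omega]
  have dΨ : lj_dt Ψ 0 = 1 := by
    have hl : HasDerivAt (fun s : ℝ => ((0 : E × E), s)) ((0, 1) : (E × E) × ℝ) 0 :=
      (hasDerivAt_const _ _).prodMk (hasDerivAt_id _)
    have h1 := (aΨ.differentiableAt.hasFDerivAt).comp_hasDerivAt (0:ℝ) hl
    have h2 : HasDerivAt (Ψ ∘ fun s : ℝ => ((0 : E × E), s)) 1 0 := by
      have : (Ψ ∘ fun s : ℝ => ((0 : E × E), s)) = fun s => s := funext Ψ0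
      rw [this]; exact hasDerivAt_id _
    exact h1.unique h2
  obtain ⟨S, hS, hS0, hSΨ⟩ := lj_ift aΨ (Ψ0 0) (by rw [dΨ]; norm_num)
  refine ⟨fun X => S X + -h 0, hS.add analyticAt_const, ?_⟩
  have tX : Tendsto (fun x => (x, w x)) (𝓝 0) (𝓝 (0 : E × E)) := rg_pair hw
  have tS : Tendsto (fun x => S (x, w x)) (𝓝 0) (𝓝 0) := (lj_tendsto hS hS0).comp tX
  have tf : Tendsto (fun x => f x ^ (r + 1)) (𝓝 0) (𝓝 0) :=
    lj_tendsto (hf.pow (r + 1)) (by simp [hf0])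
  have tp : Tendsto (fun x => (((x, w x), S (x, w x)), f x ^ (r + 1))) (𝓝 0)
      (𝓝 (0 : ((E × E) × ℝ) × ℝ)) := by
    have := (tX.prodMk_nhds tS).prodMk_nhds tf
    simpa only [Prod.mk_zero_zero] using this
  filter_upwards [tp.eventually hT, tX.eventually hSΨ, pm_Dg hf hh (r + 1) hgf, hdw, hgf]
    with x h1 h2 h3 h4 h5
  simp only [hΨ] at h2
  rw [smul_smul, h1, h3 _ h4]
  push_cast
  have h6 : g x = f x + h x * f x ^ (r + 2) := by linarith
  rw [h6]
  have : ∀ a b : ℝ, b = 0 → a + f x ^ (r + 2) * b = a := by intro a b hb; simp [hb]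
  refine Eq.trans ?_ (this (f x) _ h2)
  ring

end SecPart9

section SecPart10
open Filter Topology Set

theorem pm_inv {E : Type*} [NormedAddCommGroup E] [NormedSpace ℝ E] [CompleteSpace E]
    {φ : E → E} {r : ℕ} (hr : 1 ≤ r) (h0 : φ 0 = 0) (hφ : ContDiffAt ℝ r φ 0)
    (hd : HasFDerivAt φ (ContinuousLinearMap.id ℝ E) 0) {P : E → Prop} (hP : ∀ᶠ x in 𝓝 0, P x) :
    ∃ (ψ : E → E) (U V : Set E), IsOpen U ∧ IsOpen V ∧ (0 : E) ∈ U ∧ (0 : E) ∈ V ∧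
      Set.MapsTo φ U V ∧ Set.MapsTo ψ V U ∧
      ContDiffOn ℝ r φ U ∧ ContDiffOn ℝ r ψ V ∧
      (∀ x ∈ U, ψ (φ x) = x) ∧ (∀ y ∈ V, φ (ψ y) = y) ∧ ∀ x ∈ U, P x := by
  have hn : (r : WithTop ℕ∞) ≠ 0 := by
    have : r ≠ 0 := by omega
    exact_mod_cast this
  have hd' : HasFDerivAt φ ((ContinuousLinearEquiv.refl ℝ E : E ≃L[ℝ] E) : E →L[ℝ] E) 0 := hd
  set e := hφ.toOpenPartialHomeomorph φ hd' hn with he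
  have hs : (0 : E) ∈ e.source := hφ.mem_toOpenPartialHomeomorph_source hd' hn
  have ht : (0 : E) ∈ e.target := by
    have := hφ.image_mem_toOpenPartialHomeomorph_target hd' hn
    rwa [h0] at this
  have hψ : ContDiffAt ℝ r e.symm 0 := by
    have := hφ.to_localInverse hd' hn
    rwa [h0] at this
  have hce : ∀ x, e x = φ x := fun x => rfl
  have hψ0 : e.symm 0 = 0 := by
    have := e.left_inv hs
    rwa [hce, h0] at this
  obtain ⟨U0, hU0, hU0o, hU00⟩ := eventually_nhds_iff.1 ((hφ.eventually (by simp)).and hP)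
  obtain ⟨V0, hV0, hV0o, hV00⟩ := eventually_nhds_iff.1 (hψ.eventually (by simp))
  refine ⟨e.symm, (e.source ∩ e ⁻¹' V0) ∩ U0, (e.target ∩ e.symm ⁻¹' U0) ∩ V0,
    (e.isOpen_inter_preimage hV0o).inter hU0o, (e.symm.isOpen_inter_preimage hU0o).inter hV0o,
    ⟨⟨hs, ?_⟩, hU00⟩, ⟨⟨ht, ?_⟩, hV00⟩, ?_, ?_, ?_, ?_, ?_, ?_, ?_⟩
  · simpa [hce, h0] using hV00
  · simpa [hψ0] using hU00
  · rintro x ⟨⟨hx, hxV⟩, hxU⟩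
    refine ⟨⟨e.map_source hx, ?_⟩, hxV⟩
    have := e.left_inv hx
    change e.symm (e x) ∈ U0
    rwa [this]
  · rintro y ⟨⟨hy, hyU⟩, hyV⟩
    refine ⟨⟨e.map_target hy, ?_⟩, hyU⟩
    have := e.right_inv hy
    change e (e.symm y) ∈ V0
    rwa [this]
  · exact fun x hx => (hU0 x hx.2).1.contDiffWithinAt
  · exact fun x hx => (hV0 x hx.2).contDiffWithinAt
  · exact fun x hx => e.left_inv hx.1.1
  · exact fun y hy => e.right_inv hy.1.1
  · exact fun x hx => (hU0 x hx.2).2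

theorem pm_final {E : Type*} [NormedAddCommGroup E] [InnerProductSpace ℝ E] [FiniteDimensional ℝ E]
    (f g : E → ℝ) (r : ℕ) (hr : 1 ≤ r)
    (hf : AnalyticAt ℝ f 0) (hg : AnalyticAt ℝ g 0) (hf0 : f 0 = 0)
    (hmem : ∃ h : E → ℝ, AnalyticAt ℝ h 0 ∧
      ∀ᶠ x in nhds 0, g x - f x = h x * f x ^ (r + 2)) :
    ∃ φ : E → E, φ 0 = 0 ∧ ContDiffAt ℝ r φ 0 ∧ HasFDerivAt φ (ContinuousLinearMap.id ℝ E) 0 ∧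
      ∀ᶠ x in 𝓝 0, f x = g (φ x) := by
  have : CompleteSpace E := FiniteDimensional.complete ℝ E
  obtain ⟨h, hh, hgf⟩ := hmem
  set v : E → E := fun x => (InnerProductSpace.toDual ℝ E).symm (fderiv ℝ f x) with hvdef
  have hv : AnalyticAt ℝ v 0 := by
    let L : (E →L[ℝ] ℝ) →ₗ[ℝ] E :=
      { toFun := fun y => (InnerProductSpace.toDual ℝ E).symm y
        map_add' := fun a b => map_add _ a b
        map_smul' := fun c a => by simp }
    have hL : AnalyticAt ℝ (LinearMap.toContinuousLinearMap L) (fderiv ℝ f 0) :=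
      ContinuousLinearMap.analyticAt _ _
    exact hL.comp hf.fderiv
  have hvn : ∀ x, ‖v x‖ = ‖fderiv ℝ f x‖ := fun x => LinearIsometryEquiv.norm_map _ _
  have hvz : ∀ x, v x = 0 → fderiv ℝ f x = 0 := by
    intro x hx
    rw [← norm_eq_zero, ← hvn, hx, norm_zero]
  have hZ : ∀ᶠ x in 𝓝 0, v x = 0 → f x = 0 ∧ fderiv ℝ f x = 0 := by
    filter_upwards [lj_loj hf hf0 one_pos] with x hx hvx
    have := hvz x hvx
    rw [this] at hx
    simp at hx
    exact ⟨hx, this⟩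
  have hw : Tendsto (rg_w f v) (𝓝 0) (𝓝 0) := by
    rw [Metric.tendsto_nhds]
    intro ε hε
    filter_upwards [lj_loj hf hf0 (half_pos hε)] with x hx
    rw [dist_zero_right, rg_w, norm_smul]
    by_cases hvx : v x = 0
    · simp [hvx, hε]
    · have hpos : 0 < ‖v x‖ := norm_pos_iff.2 hvx
      rw [← hvn] at hx
      have : ‖f x * (‖v x‖ ^ 2)⁻¹‖ * ‖v x‖ = |f x| / ‖v x‖ := by
        rw [norm_mul, Real.norm_eq_abs, norm_inv, norm_pow, norm_norm]
        field_simp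
      rw [this, div_lt_iff₀ hpos]
      nlinarith
  have hdw : ∀ᶠ x in 𝓝 0, fderiv ℝ f x (rg_w f v x) = f x := by
    filter_upwards [hZ] with x hx
    by_cases hvx : v x = 0
    · rw [(hx hvx).1, (hx hvx).2]; simp
    · have h1 : fderiv ℝ f x (v x) = ‖v x‖ ^ 2 := by
        rw [← real_inner_self_eq_norm_sq, hvdef]
        exact (InnerProductSpace.toDual_symm_apply).symm
      have hpos : 0 < ‖v x‖ := norm_pos_iff.2 hvx
      rw [rg_w, map_smul, h1, smul_eq_mul]
      field_simp
  obtain ⟨S, hS, hSg⟩ := pm_sigma hf hg hh hf0 r hr hgf hw hdw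
  set Θ : E × E → E := fun X => S X • X.2 with hΘdef
  have hΘ : ContDiffAt ℝ (⊤ : ℕ∞) Θ 0 := hS.contDiffAt.smul contDiffAt_snd
  have cf : ContDiffAt ℝ (⊤ : ℕ∞) f 0 := hf.contDiffAt
  have cv : ContDiffAt ℝ (⊤ : ℕ∞) v 0 := hv.contDiffAt
  refine ⟨fun x => x + f x ^ (r + 1) • Θ (x, rg_w f v x), ?_, ?_, ?_, ?_⟩
  · simp [hf0]
  · exact contDiffAt_id.add (rg_main cf cv hw hZ r E Θ (r + 1) hΘ le_rfl)
  · have hD := (rg_D r hr cf cv hΘ hw hZ).self_of_nhds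
    rw [hf0, zero_pow (by omega), zero_smul] at hD
    have := (hasFDerivAt_id (𝕜 := ℝ) (0 : E)).add hD
    rw [add_zero] at this
    exact this
  · filter_upwards [hSg] with x hx
    exact hx.symm

end SecPart10

/-- Main Theorem: if `f, g` are analytic near `0` with `f(0) = g(0) = 0`,
`∇f(0) = 0`, `r ≥ 1`, and `g − f ∈ (f)^{r+2}` (i.e. `g − f = h·f^{r+2}` for an analytic
germ `h`), then `f` and `g` are `C^r`-right equivalent: there is a `C^r` diffeomorphism
`φ : (ℝⁿ,0) → (ℝⁿ,0)` with `f = g ∘ φ` near `0`. -/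
theorem stmt14 {n : ℕ} (f g : EuclideanSpace ℝ (Fin n) → ℝ) (r : ℕ) (hr : 1 ≤ r)
    (hf : AnalyticAt ℝ f 0) (hg : AnalyticAt ℝ g 0) (hf0 : f 0 = 0) (hg0 : g 0 = 0)
    (hgrad : gradient f 0 = 0)
    (hmem : ∃ h : EuclideanSpace ℝ (Fin n) → ℝ, AnalyticAt ℝ h 0 ∧
      ∀ᶠ x in nhds 0, g x - f x = h x * f x ^ (r + 2)) :
    ∃ (φ ψ : EuclideanSpace ℝ (Fin n) → EuclideanSpace ℝ (Fin n))
      (U V : Set (EuclideanSpace ℝ (Fin n))),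
      IsOpen U ∧ IsOpen V ∧ (0 : EuclideanSpace ℝ (Fin n)) ∈ U ∧
      (0 : EuclideanSpace ℝ (Fin n)) ∈ V ∧ φ 0 = 0 ∧
      Set.MapsTo φ U V ∧ Set.MapsTo ψ V U ∧
      ContDiffOn ℝ r φ U ∧ ContDiffOn ℝ r ψ V ∧
      (∀ x ∈ U, ψ (φ x) = x) ∧ (∀ y ∈ V, φ (ψ y) = y) ∧
      ∀ x ∈ U, f x = g (φ x) := by
  obtain ⟨φ, h0, hφ, hd, hP⟩ := pm_final f g r hr hf hg hf0 hmem
  obtain ⟨ψ, U, V, h1, h2, h3, h4, h5, h6, h7, h8, h9, h10, h11⟩ := pm_inv hr h0 hφ hd hP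
  exact ⟨φ, ψ, U, V, h1, h2, h3, h4, h0, h5, h6, h7, h8, h9, h10, h11⟩
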